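/- Let L ⊆ V^P be an isotropic subspace free of zero, trivial, and Bell factors. Then after a suitable local symplectic transformation of V^P and for a suitable choice of the section σ, the connected component of the identity of the automorphism group is A_c(L,σ) = {(g_p)_{p∈P} ∈ (C_z)^P : Π_{s∈S} g_s = 1 for every protected contiguity class S ∈ 𝒮}. In particular this torus has dimension |P| minus the number of protected contiguity classes. -/

import Mathlib

/- Common framework: binary stabilizer codes, local unitary/SO(3) automorphism groups. -/

noncomputable section
open scoped Matrix Real ComplexConjugate
open scoped Classical

namespace Stab

/-- The one-qubit phase space `V = 𝔽₂ ⊕ 𝔽₂`, with first coordinate the `z`-component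
and second coordinate the `x`-component. -/
abbrev V : Type := ZMod 2 × ZMod 2

/-- The symplectic form on `V`. -/
def omegaV (u v : V) : ZMod 2 := u.1 * v.2 + u.2 * v.1

/-- The phase space `V^P` over a set of qubits `P`. -/
abbrev QV (P : Type) := P → V

variable {P : Type} [Fintype P] [DecidableEq P]

/-- The direct-sum symplectic form on `V^P`. -/
def omega (u v : QV P) : ZMod 2 := ∑ p, omegaV (u p) (v p)

/-- A subspace `L ⊆ V^P` is isotropic if `ω` vanishes identically on `L × L`. -/
def Isotropic (L : Submodule (ZMod 2) (QV P)) : Prop := ∀ u ∈ L, ∀ v ∈ L, omega u v = 0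

/-- Support of a vector of `V^P`. -/
def supp (v : QV P) : Set P := {p | v p ≠ 0}

/-- The basis vector `z_p`. -/
def zvec (p : P) : QV P := Pi.single p ((1 : ZMod 2), (0 : ZMod 2))

/-- The basis vector `x_p`. -/
def xvec (p : P) : QV P := Pi.single p ((0 : ZMod 2), (1 : ZMod 2))

/-- Restriction (coordinate projection) of a vector to a subset `S ⊆ P`. -/
def restrTo (S : Set P) (v : QV P) : QV P := fun p => if p ∈ S then v p else 0

/-- The coordinate subspace `V^S ⊆ V^P`. -/
def coordSub (S : Set P) : Submodule (ZMod 2) (QV P) where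
  carrier := {v | ∀ p ∉ S, v p = 0}
  add_mem' := by intro a b ha hb p hp; simp [Pi.add_apply, ha p hp, hb p hp]
  zero_mem' := by intro p _; rfl
  smul_mem' := by intro c a ha p hp; simp [Pi.smul_apply, ha p hp]

/-- `L_S := L ∩ V^S`. -/
def LS (L : Submodule (ZMod 2) (QV P)) (S : Set P) : Submodule (ZMod 2) (QV P) :=
  L ⊓ coordSub S

/-- `L` splits as a direct factor on `S`, i.e. `L = L_S × L_{P∖S}`. -/
def SplitsOn (L : Submodule (ZMod 2) (QV P)) (S : Set P) : Prop :=
  ∀ v ∈ L, restrTo S v ∈ L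

/-- `L` splits off a zero factor: on some nonempty `S ⊆ P` all vectors of `L` vanish. -/
def HasZeroFactor (L : Submodule (ZMod 2) (QV P)) : Prop :=
  ∃ S : Set P, S.Nonempty ∧ ∀ v ∈ L, ∀ p ∈ S, v p = 0

/-- The qubit `p` is trivial: `L` splits off a one-dimensional factor on `{p}`. -/
def TrivialQubit (L : Submodule (ZMod 2) (QV P)) (p : P) : Prop :=
  SplitsOn L {p} ∧ ∃ v ∈ L, v ≠ 0 ∧ supp v ⊆ {p}

/-- `L` splits off a trivial factor. -/
def HasTrivialFactor (L : Submodule (ZMod 2) (QV P)) : Prop :=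
  ∃ p : P, TrivialQubit L p

/-- `L` splits off a Bell Lagrangian: an indecomposable Lagrangian direct factor on a
two-element set of qubits (all of whose nonzero vectors have full support `{p, q}`). -/
def HasBellFactor (L : Submodule (ZMod 2) (QV P)) : Prop :=
  ∃ p q : P, p ≠ q ∧ SplitsOn L {p, q} ∧
    ∃ v ∈ L, ∃ w ∈ L, v ≠ w ∧ supp v = {p, q} ∧ supp w = {p, q} ∧ supp (v + w) = {p, q}

/-- The factor `L_S` (for `S` in a partition) is indecomposable. -/
def IndecompWithin (L : Submodule (ZMod 2) (QV P)) (S : Set P) : Prop :=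
  ∀ T ⊆ S, SplitsOn L T → T = ∅ ∨ T = S

/-! ### The Hilbert space, Pauli operators and stabilizer codes -/

/-- The state space `ℋ^{⊗P} = (ℂ²)^{⊗P}`, realised concretely as functions on
computational basis labels. -/
abbrev HP (P : Type) := (P → Fin 2) → ℂ

/-- Operators on `ℋ^{⊗P}` as matrices. -/
abbrev MatP (P : Type) := Matrix (P → Fin 2) (P → Fin 2) ℂ

/-- The tensor (local) operator `⊗_{p} g_p` on `ℋ^{⊗P}`. -/
def locOp (g : P → Matrix (Fin 2) (Fin 2) ℂ) : MatP P :=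
  Matrix.of fun u w => ∏ p, g p (u p) (w p)

def sigmaX : Matrix (Fin 2) (Fin 2) ℂ := !![0, 1; 1, 0]
def sigmaY : Matrix (Fin 2) (Fin 2) ℂ := !![0, -Complex.I; Complex.I, 0]
def sigmaZ : Matrix (Fin 2) (Fin 2) ℂ := !![1, 0; 0, -1]

/-- The one-qubit Pauli operator `Z^a X^b` attached to `(a, b) ∈ V`. -/
def pauliMat (v : V) : Matrix (Fin 2) (Fin 2) ℂ := sigmaZ ^ (v.1 : ZMod 2).val * sigmaX ^ (v.2 : ZMod 2).val

/-- The Pauli (Weyl) operator attached to `v ∈ V^P`. -/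
def Wop (v : QV P) : MatP P := locOp fun p => pauliMat (v p)

/-- A group-homomorphic section `σ` over `L` of the projection from the Pauli group
`Ṽ^P` onto `V^P`: each value `σ(v)` is a unitary scalar multiple of the Pauli operator
`W(v)`, and `σ` is multiplicative on `L`. -/
structure PauliSection (L : Submodule (ZMod 2) (QV P)) where
  toFun : QV P → MatP P
  scalar : ∀ v : QV P, ∃ c : ℂ, toFun v = c • Wop v
  unitary : ∀ v : QV P, toFun v ∈ Matrix.unitaryGroup (P → Fin 2) ℂ
  mul_of_mem : ∀ u ∈ L, ∀ v ∈ L, toFun (u + v) = toFun u * toFun v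
  map_zero : toFun 0 = 1

/-- The stabilizer code `C(L, σ)`: the common fixed-point space of the stabilizer
group `σ(L)`. -/
def code (L : Submodule (ZMod 2) (QV P)) (σ : PauliSection L) : Submodule ℂ (HP P) where
  carrier := {ψ | ∀ v ∈ L, σ.toFun v *ᵥ ψ = ψ}
  add_mem' := by intro a b ha hb v hv; rw [Matrix.mulVec_add, ha v hv, hb v hv]
  zero_mem' := by intro v hv; simp
  smul_mem' := by intro c a ha v hv; rw [Matrix.mulVec_smul, ha v hv]

/-- The standard section: `σ(v) = W(v)` on `L`. -/
def StandardOn (L : Submodule (ZMod 2) (QV P)) (σ : PauliSection L) : Prop :=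
  ∀ v ∈ L, σ.toFun v = Wop v

/-! ### `SO(3)`, rotations, and the automorphism group of a code -/

/-- `3×3` real matrices. -/
abbrev Rot : Type := Matrix (Fin 3) (Fin 3) ℝ

/-- `SO(3)` as a set of `3×3` real matrices. -/
def SO3 : Set Rot := {A | A * Aᵀ = 1 ∧ A.det = 1}

/-- The ordered Pauli basis (x, y, z) of traceless Hermitian `2×2` matrices. -/
def pauliBasis : Fin 3 → Matrix (Fin 2) (Fin 2) ℂ := ![sigmaX, sigmaY, sigmaZ]

/-- The image of a unitary `u ∈ U(2)` in `SO(3)` under the adjoint action on traceless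
Hermitian operators (the identification `U(2)/S¹ = SO(3)`):
`u σ_j u† = Σ_i (adjRot u)_{ij} σ_i`. -/
def adjRot (u : Matrix (Fin 2) (Fin 2) ℂ) : Rot :=
  Matrix.of fun i j =>
    (1 / 2 : ℝ) * ((pauliBasis i * u * pauliBasis j * u.conjTranspose).trace).re

/-- Rotation about the `x`-axis by angle `θ`. -/
def rotX (θ : ℝ) : Rot := !![1, 0, 0; 0, Real.cos θ, -Real.sin θ; 0, Real.sin θ, Real.cos θ]

/-- Rotation about the `y`-axis by angle `θ`. -/
def rotY (θ : ℝ) : Rot := !![Real.cos θ, 0, Real.sin θ; 0, 1, 0; -Real.sin θ, 0, Real.cos θ]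

/-- Rotation about the `z`-axis by angle `θ`. -/
def rotZ (θ : ℝ) : Rot := !![Real.cos θ, -Real.sin θ, 0; Real.sin θ, Real.cos θ, 0; 0, 0, 1]

/-- The circle group `C_x ⊆ SO(3)` of rotations about the `x`-axis. -/
def Cx : Set Rot := Set.range rotX

/-- The circle group `C_y ⊆ SO(3)` of rotations about the `y`-axis. -/
def Cy : Set Rot := Set.range rotY

/-- The circle group `C_z ⊆ SO(3)` of rotations about the `z`-axis. -/
def Cz : Set Rot := Set.range rotZ

/-- The octahedral group: the subgroup of `SO(3)` generated by the rotations by a right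
angle about the three coordinate axes. -/
def octahedral : Set Rot :=
  (Submonoid.closure {rotX (π / 2), rotY (π / 2), rotZ (π / 2)} : Submonoid Rot)

/-- The infinite dihedral group `D_x ⊆ SO(3)`. -/
def Dx : Set Rot := (Submonoid.closure (Cx ∪ {rotZ π}) : Submonoid Rot)

/-- The infinite dihedral group `D_y ⊆ SO(3)`. -/
def Dy : Set Rot := (Submonoid.closure (Cy ∪ {rotZ π}) : Submonoid Rot)

/-- The infinite dihedral group `D_z ⊆ SO(3)`. -/
def Dz : Set Rot := (Submonoid.closure (Cz ∪ {rotX π}) : Submonoid Rot)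

/-- The automorphism group `A(L, σ) ⊆ SO(3)^P` of the stabilizer code `C(L, σ)`:
all families of rotations admitting a local unitary lift mapping the code into itself. -/
def autSet (L : Submodule (ZMod 2) (QV P)) (σ : PauliSection L) : Set (P → Rot) :=
  {g | ∃ u : P → Matrix (Fin 2) (Fin 2) ℂ,
        (∀ p, u p ∈ Matrix.unitaryGroup (Fin 2) ℂ) ∧
        (∀ p, adjRot (u p) = g p) ∧
        ∀ ψ ∈ code L σ, locOp u *ᵥ ψ ∈ code L σ}

/-- The automorphism group `A(L, σ)_p` at the qubit `p`. -/
def autSetAt (L : Submodule (ZMod 2) (QV P)) (σ : PauliSection L) (p : P) : Set Rot :=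
  (fun g => g p) '' autSet L σ

/-- The normal subgroup `Z(L, σ)` of automorphisms acting by a scalar on the code. -/
def zSet (L : Submodule (ZMod 2) (QV P)) (σ : PauliSection L) : Set (P → Rot) :=
  {g | ∃ u : P → Matrix (Fin 2) (Fin 2) ℂ,
        (∀ p, u p ∈ Matrix.unitaryGroup (Fin 2) ℂ) ∧
        (∀ p, adjRot (u p) = g p) ∧
        ∃ c : ℂ, ∀ ψ ∈ code L σ, locOp u *ᵥ ψ = c • ψ}

/-! ### Restriction to subsets of qubits -/

/-- Restriction of a phase-space vector to the qubits of `S`. -/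
def resQV (S : Set P) (v : QV P) : QV ↥S := fun s => v s

/-- Restriction as a linear map. -/
def resLin (S : Set P) : QV P →ₗ[ZMod 2] QV ↥S where
  toFun := resQV S
  map_add' := by intros; rfl
  map_smul' := by intros; rfl

/-- `L_S`, regarded as a subspace of `V^S`. -/
def LSsub (L : Submodule (ZMod 2) (QV P)) (S : Set P) : Submodule (ZMod 2) (QV ↥S) :=
  Submodule.map (resLin S) (LS L S)

/-- The extension `M ⊗ 1` to `ℋ^{⊗P}` of an operator `M` on `ℋ^{⊗S}`. -/
def extendOp (S : Set P) (M : Matrix (↥S → Fin 2) (↥S → Fin 2) ℂ) : MatP P :=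
  Matrix.of fun u w =>
    if ∀ p ∉ S, u p = w p then M (fun s => u s) (fun s => w s) else 0

/-- `σ'` is the restriction `σ|_{L_S}` of the section `σ` to `L_S`. -/
def RestrictedSection (L : Submodule (ZMod 2) (QV P)) (σ : PauliSection L) (S : Set P)
    (σ' : PauliSection (LSsub L S)) : Prop :=
  ∀ v ∈ LS L S, extendOp S (σ'.toFun (resQV S v)) = σ.toFun v

/-! ### Contiguity, protected and gauge qubits, and normal forms -/

/-- Two qubits are contiguous if they are equal or `L` contains a vector supported
exactly on the pair. -/
def Contig (L : Submodule (ZMod 2) (QV P)) (p q : P) : Prop :=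
  p = q ∨ ∃ v ∈ L, supp v = ({p, q} : Set P)

/-- The contiguity class of a qubit. -/
def contigClass (L : Submodule (ZMod 2) (QV P)) (p : P) : Set P := {q | Contig L p q}

/-- The qubit `p` is protected: the projection `L → V^{{p}}` is surjective. -/
def IsProtected (L : Submodule (ZMod 2) (QV P)) (p : P) : Prop :=
  ∀ w : V, ∃ v ∈ L, v p = w

/-- The qubit `p` is of gauge type: the projection `L → V^{{p}}` has a line as image. -/
def IsGauge (L : Submodule (ZMod 2) (QV P)) (p : P) : Prop :=
  ¬ IsProtected L p ∧ ∃ v ∈ L, v p ≠ 0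

/-- The subspace `⟨z_a + z_b : a ≠ b ∈ S⟩`. -/
def zspan (S : Set P) : Submodule (ZMod 2) (QV P) :=
  Submodule.span (ZMod 2) {w | ∃ a ∈ S, ∃ b ∈ S, a ≠ b ∧ w = zvec a + zvec b}

/-- The vector `Σ_{s ∈ S} x_s`. -/
def xsumOn (S : Set P) : QV P := S.indicator fun _ => ((0 : ZMod 2), (1 : ZMod 2))

/-- Normal form of `L` (conclusion of the normalisation lemma): every contiguity class `S`
carries either `⟨z_a + z_b⟩` or `⟨z_a + z_b⟩ + ⟨Σ_{s∈S} x_s⟩`. -/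
def NormalForm (L : Submodule (ZMod 2) (QV P)) : Prop :=
  ∀ p : P,
    LS L (contigClass L p) = zspan (contigClass L p) ∨
    LS L (contigClass L p) =
      zspan (contigClass L p) ⊔ Submodule.span (ZMod 2) {xsumOn (contigClass L p)}

/-- The pair `(L, σ)` is normalised. -/
def Normalised (L : Submodule (ZMod 2) (QV P)) (σ : PauliSection L) : Prop :=
  NormalForm L ∧
  (∀ p : P, IsGauge L p → contigClass L p = {p} → ∀ v ∈ L, (v p).2 = 0) ∧
  (∀ p : P, IsProtected L p → contigClass L p = {p} →
    connectedComponentIn (autSetAt L σ p) 1 ⊆ Cz) ∧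
  (∀ p : P, IsProtected L p → contigClass L p ≠ {p} →
    LS L (contigClass L p) = zspan (contigClass L p) →
    ∃ v ∈ L, ∀ s ∈ contigClass L p, v s = ((0 : ZMod 2), (1 : ZMod 2))) ∧
  (∀ p q : P, p ≠ q → Contig L p q →
    σ.toFun (zvec p + zvec q) = Wop (zvec p + zvec q))

/-- A local symplectic family of automorphisms of `V`. -/
def IsLocalSymp (f : P → (V ≃ₗ[ZMod 2] V)) : Prop :=
  ∀ (p : P) (u v : V), omegaV (f p u) (f p v) = omegaV u v

/-- The image of `L` under a local (symplectic) transformation. -/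
def mapL (L : Submodule (ZMod 2) (QV P)) (f : P → (V ≃ₗ[ZMod 2] V)) :
    Submodule (ZMod 2) (QV P) :=
  Submodule.map (LinearEquiv.piCongrRight f : QV P ≃ₗ[ZMod 2] QV P).toLinearMap L

/-! ### Abstract group structures carried by subsets of a monoid -/

/-- The set `s` carries the structure of a solvable group. -/
structure SolvableGroupStructure (M : Type) [Monoid M] (s : Set M) where
  G : Type
  [grp : Group G]
  solv : IsSolvable G
  f : G → M
  inj : Function.Injective f
  map_mul : ∀ a b : G, f (a * b) = f a * f b
  range_eq : Set.range f = s

/-- The quotient of the group (carried by) `A` by the normal subgroup (carried by) `Z`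
is a compact solvable topological (Lie) group. -/
structure CompactSolvableQuotientStructure (M : Type) [Monoid M] [TopologicalSpace M]
    (A Z : Set M) where
  G : Type
  [grp : Group G]
  [top : TopologicalSpace G]
  [tgrp : IsTopologicalGroup G]
  cpt : CompactSpace G
  solv : IsSolvable G
  φ : M → G
  cont : ContinuousOn φ A
  map_mul' : ∀ a ∈ A, ∀ b ∈ A, φ (a * b) = φ a * φ b
  surj : ∀ y : G, ∃ a ∈ A, φ a = y
  ker : ∀ a ∈ A, (φ a = 1 ↔ a ∈ Z)

/-! ### Logical qubits and transversally realisable gates -/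

/-- The standard hermitian inner product on a finite-dimensional function space. -/
def innerF {ι : Type} [Fintype ι] (ψ φ : ι → ℂ) : ℂ := ∑ i, (starRingEnd ℂ) (ψ i) * φ i

/-- `e` is a unitary identification of the code space with a space of logical qubits. -/
def IsUnitaryEquiv (L : Submodule (ZMod 2) (QV P)) (σ : PauliSection L) {d : ℕ}
    (e : ↥(code L σ) ≃ₗ[ℂ] HP (Fin d)) : Prop :=
  ∀ ψ φ : ↥(code L σ),
    innerF (e ψ) (e φ) = innerF (ψ : HP P) (φ : HP P)

/-- The operator acting as `w` on the logical qubit `k` and trivially elsewhere. -/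
def oneQubitOp (d : ℕ) (k : Fin d) (w : Matrix (Fin 2) (Fin 2) ℂ) : MatP (Fin d) :=
  locOp fun j => if j = k then w else 1

/-- The set of rotations in `SO(3)` induced, via the identification `e`, on a fixed
logical qubit `k` by (exactly realised) transversal gates, i.e. by elements of `A(L, σ)`. -/
def logicalSet (L : Submodule (ZMod 2) (QV P)) (σ : PauliSection L) {d : ℕ}
    (e : ↥(code L σ) ≃ₗ[ℂ] HP (Fin d)) (k : Fin d) : Set Rot :=
  {A | ∃ w ∈ Matrix.unitaryGroup (Fin 2) ℂ, adjRot w = A ∧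
        ∃ u : P → Matrix (Fin 2) (Fin 2) ℂ,
          (∀ p, u p ∈ Matrix.unitaryGroup (Fin 2) ℂ) ∧
          ∀ φ : HP (Fin d),
            locOp u *ᵥ ((e.symm φ : HP P)) = ((e.symm (oneQubitOp d k w *ᵥ φ) : HP P))}

/-! ### Reed–Muller codes -/

/-- The qubit set `P = 𝔽₂^m ∖ {0}`. -/
abbrev RMQubits (m : ℕ) := {s : Fin m → ZMod 2 // s ≠ 0}

/-- Polynomial functions on `𝔽₂^m` of degree at most `r` with zero constant term. -/
def RMspan (r m : ℕ) : Submodule (ZMod 2) ((Fin m → ZMod 2) → ZMod 2) :=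
  Submodule.span (ZMod 2)
    {f | ∃ I : Finset (Fin m), I.Nonempty ∧ I.card ≤ r ∧ f = fun s => ∏ i ∈ I, s i}

/-- The shortened Reed–Muller code `R_*(r, m) ⊆ 𝔽₂^P`. -/
def RMstar (r m : ℕ) : Submodule (ZMod 2) (RMQubits m → ZMod 2) :=
  Submodule.map (LinearMap.funLeft (ZMod 2) (ZMod 2) Subtype.val) (RMspan r m)

/-- The `z`-part of a phase-space vector. -/
def zPart {P : Type} : QV P →ₗ[ZMod 2] (P → ZMod 2) where
  toFun v := fun p => (v p).1
  map_add' := by intros; rfl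
  map_smul' := by intros; rfl

/-- The `x`-part of a phase-space vector. -/
def xPart {P : Type} : QV P →ₗ[ZMod 2] (P → ZMod 2) where
  toFun v := fun p => (v p).2
  map_add' := by intros; rfl
  map_smul' := by intros; rfl

/-- The Calderbank–Shor–Steane isotropic subspace built from the shortened Reed–Muller
codes `R_*(m−2, m)` (in the `z`-coordinates) and `R_*(1, m)` (in the `x`-coordinates). -/
def cssL (m : ℕ) : Submodule (ZMod 2) (QV (RMQubits m)) :=
  Submodule.comap zPart (RMstar (m - 2) m) ⊓ Submodule.comap xPart (RMstar 1 m)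

/-- The stabilizer state `|0⟩_S ⊗ |0⟩_T + |0⟩_S ⊗ |1⟩_T + |1⟩_S ⊗ |0⟩_T − |1⟩_S ⊗ |1⟩_T`
(with `T = Sᶜ`), written in the computational basis. -/
def bellLike (S : Set P) (p q : P) : HP P := fun u =>
  if (∀ a ∈ S, u a = u p) ∧ (∀ a ∈ Sᶜ, u a = u q) then
    ((-1 : ℂ)) ^ ((u p : Fin 2).val * (u q : Fin 2).val) else 0


set_option linter.unusedSectionVars false

theorem omegaV_eq_zero_iff {u v : V} (hu : u ≠ 0) (hv : v ≠ 0) : omegaV u v = 0 ↔ u = v := by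
  revert u v; decide

theorem exists_symp_map_eq {a : V} (ha : a ≠ 0) :
    ∃ f : V ≃ₗ[ZMod 2] V, (∀ u v, omegaV (f u) (f v) = omegaV u v) ∧ f a = (1, 0) := by
  have key : a = (1, 0) ∨ a = (0, 1) ∨ a = (1, 1) := by revert a; decide
  rcases key with rfl | rfl | rfl
  · exact ⟨LinearEquiv.refl _ _, fun _ _ => rfl, rfl⟩
  · exact ⟨LinearEquiv.prodComm _ _ _, by decide, rfl⟩
  · refine ⟨LinearEquiv.ofInvolutive
      (LinearMap.prod (LinearMap.fst (ZMod 2) (ZMod 2) (ZMod 2))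
        (LinearMap.fst (ZMod 2) (ZMod 2) (ZMod 2) + LinearMap.snd (ZMod 2) (ZMod 2) (ZMod 2)))
      ?_, ?_, ?_⟩
    · intro v; revert v; decide
    · intro u v; revert u v; decide
    · decide

theorem mem_supp {v : QV P} {p : P} : p ∈ supp v ↔ v p ≠ 0 := Iff.rfl

theorem supp_eq_pair_iff {v : QV P} {p q : P} :
    supp v = {p, q} ↔ v p ≠ 0 ∧ v q ≠ 0 ∧ ∀ r, r ≠ p → r ≠ q → v r = 0 := by
  constructor
  · intro h
    have h' : ∀ r, v r ≠ 0 ↔ r = p ∨ r = q := fun r => by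
      rw [← mem_supp, h]; simp
    refine ⟨(h' p).2 (.inl rfl), (h' q).2 (.inr rfl), fun r hp hq => ?_⟩
    by_contra hr
    rcases (h' r).1 hr with h | h
    exacts [hp h, hq h]
  · rintro ⟨hp, hq, h⟩
    ext r
    simp only [mem_supp, Set.mem_insert_iff, Set.mem_singleton_iff]
    constructor
    · intro hr
      by_contra hc
      push Not at hc
      exact hr (h r hc.1 hc.2)
    · rintro (rfl | rfl)
      exacts [hp, hq]

theorem omega_eq_single {u v : QV P} {p : P} (h : ∀ r, r ≠ p → u r = 0) :
    omega u v = omegaV (u p) (v p) := by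
  unfold omega
  refine Finset.sum_eq_single p (fun r _ hr => ?_) (by simp)
  simp [h r hr, omegaV]

theorem omega_eq_pair {u v : QV P} {p q : P} (hpq : p ≠ q)
    (h : ∀ r, r ≠ p → r ≠ q → u r = 0) :
    omega u v = omegaV (u p) (v p) + omegaV (u q) (v q) := by
  unfold omega
  refine Finset.sum_eq_add p q hpq (fun r _ hr => ?_) (by simp) (by simp)
  simp [h r hr.1 hr.2, omegaV]

section Combinatorics

variable {L : Submodule (ZMod 2) (QV P)}

theorem supp_ne_singleton (hL : Isotropic L) (htriv : ¬ HasTrivialFactor L)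
    {v : QV P} (hv : v ∈ L) {p : P} (hp : v p ≠ 0) : ∃ r, r ≠ p ∧ v r ≠ 0 := by
  by_contra hc
  push Not at hc
  refine htriv ⟨p, fun w hw => ?_, v, hv, fun h => hp (by rw [h]; rfl), fun r hr => ?_⟩
  · have h0 := hL v hv w hw
    rw [omega_eq_single hc] at h0
    by_cases hwp : w p = 0
    · have : restrTo {p} w = 0 := by
        ext1 r
        simp only [restrTo, Set.mem_singleton_iff]
        split_ifs with h
        · rw [h, hwp]; rfl
        · rfl
      rw [this]; exact L.zero_mem
    · rw [omegaV_eq_zero_iff hp hwp] at h0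
      have : restrTo {p} w = v := by
        ext1 r
        simp only [restrTo, Set.mem_singleton_iff]
        split_ifs with h
        · rw [h, h0]
        · exact (hc r h).symm
      rw [this]; exact hv
  · by_contra hrp
    exact hr (hc r hrp)

theorem eq_omegaV_smul_add {a b : V} (ha : a ≠ 0) (hb : b ≠ 0) (hab : a ≠ b) (x : V) :
    x = omegaV b x • a + omegaV a x • b := by
  revert a b x; decide

theorem eq_of_omegaV_add_eq_zero {a b c d x y : V} (ha : a ≠ 0) (hb : b ≠ 0) (hab : a ≠ b)
    (hc : c ≠ 0) (hd : d ≠ 0) (hcd : c ≠ d) (h1 : omegaV a x + omegaV c y = 0)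
    (h2 : omegaV b x + omegaV d y = 0) :
    ∃ s t : ZMod 2, x = s • a + t • b ∧ y = s • c + t • d := by
  refine ⟨omegaV b x, omegaV a x, eq_omegaV_smul_add ha hb hab x, ?_⟩
  rw [CharTwo.add_eq_zero.1 h1, CharTwo.add_eq_zero.1 h2]
  exact eq_omegaV_smul_add hc hd hcd y

theorem pair_value_unique (hL : Isotropic L) (htriv : ¬ HasTrivialFactor L)
    (hbell : ¬ HasBellFactor L) {p q r : P} (hpq : p ≠ q) (hpr : p ≠ r) {v w : QV P}
    (hv : v ∈ L) (hw : w ∈ L) (hvs : supp v = {p, q}) (hws : supp w = {p, r}) :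
    v p = w p := by
  have hvs' := supp_eq_pair_iff.1 hvs
  have hws' := supp_eq_pair_iff.1 hws
  by_contra hne
  have h0 := hL v hv w hw
  rw [omega_eq_pair hpq hvs'.2.2] at h0
  by_cases hqr : q = r
  · subst hqr
    have hvw : ∀ s, s ≠ p → s ≠ q → (v + w) s = 0 := fun s h1 h2 => by
      simp [hvs'.2.2 s h1 h2, hws'.2.2 s h1 h2]
    have hp : (v + w) p ≠ 0 := by
      intro h
      exact hne (CharTwo.add_eq_zero.1 h)
    have hq : v q ≠ w q := by
      intro h
      obtain ⟨s, hsp, hs⟩ := supp_ne_singleton hL htriv (L.add_mem hv hw) hp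
      refine hs ?_
      by_cases hsq : s = q
      · rw [hsq]; exact CharTwo.add_eq_zero.2 h
      · exact hvw s hsp hsq
    have hq' : (v + w) q ≠ 0 := by
      intro h
      exact hq (CharTwo.add_eq_zero.1 h)
    refine hbell ⟨p, q, hpq, fun u hu => ?_, v, hv, w, hw, fun h => hne (by rw [h]), hvs, hws,
      supp_eq_pair_iff.2 ⟨hp, hq', hvw⟩⟩
    have h1 := hL v hv u hu
    have h2 := hL w hw u hu
    rw [omega_eq_pair hpq hvs'.2.2] at h1
    rw [omega_eq_pair hpq hws'.2.2] at h2
    obtain ⟨a, b, hup, huq⟩ := eq_of_omegaV_add_eq_zero hvs'.1 hws'.1 hne hvs'.2.1 hws'.2.1 hq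
      h1 h2
    convert L.add_mem (L.smul_mem a hv) (L.smul_mem b hw) using 1
    ext1 s
    simp only [restrTo, Set.mem_insert_iff, Set.mem_singleton_iff]
    split_ifs with h
    · rcases h with rfl | rfl
      exacts [hup, huq]
    · push Not at h
      simp [hvs'.2.2 s h.1 h.2, hws'.2.2 s h.1 h.2]
  · rw [hws'.2.2 q hpq.symm hqr] at h0
    have : omegaV (v p) (w p) = 0 := by simpa [omegaV] using h0
    exact hne ((omegaV_eq_zero_iff hvs'.1 hws'.1).1 this)

theorem isProtected_of_ne {p : P} {v w : QV P} (hv : v ∈ L) (hw : w ∈ L) (hvp : v p ≠ 0)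
    (hwp : w p ≠ 0) (hne : v p ≠ w p) : IsProtected L p := by
  intro x
  have key : ∀ a b : V, a ≠ 0 → b ≠ 0 → a ≠ b → ∀ x : V,
    x = 0 ∨ x = a ∨ x = b ∨ x = a + b := by decide
  rcases key _ _ hvp hwp hne x with h | h | h | h
  · exact ⟨0, L.zero_mem, h.symm⟩
  · exact ⟨v, hv, h.symm⟩
  · exact ⟨w, hw, h.symm⟩
  · exact ⟨v + w, L.add_mem hv hw, h.symm⟩

theorem exists_ne_zero_of_not_hasZeroFactor (hzero : ¬ HasZeroFactor L) (p : P) :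
    ∃ v ∈ L, v p ≠ 0 := by
  by_contra hc
  push Not at hc
  exact hzero ⟨{p}, ⟨p, rfl⟩, fun v hv q hq => by rw [Set.mem_singleton_iff.1 hq, hc v hv]⟩

theorem exists_axis (hL : Isotropic L) (hzero : ¬ HasZeroFactor L)
    (htriv : ¬ HasTrivialFactor L) (hbell : ¬ HasBellFactor L) (p : P) :
    ∃ a : V, a ≠ 0 ∧ (∀ v ∈ L, ∀ q, p ≠ q → supp v = {p, q} → v p = a) ∧
      (¬ IsProtected L p → ∀ v ∈ L, v p ≠ 0 → v p = a) := by
  by_cases h : ∃ v ∈ L, ∃ q, p ≠ q ∧ supp v = {p, q}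
  · obtain ⟨v, hv, q, hpq, hvs⟩ := h
    have hvp := (supp_eq_pair_iff.1 hvs).1
    refine ⟨v p, hvp, fun w hw r hpr hws =>
      pair_value_unique hL htriv hbell hpr hpq hw hv hws hvs, fun hp w hw hwp => ?_⟩
    by_contra hne
    exact hp (isProtected_of_ne hw hv hwp hvp hne)
  · obtain ⟨v, hv, hvp⟩ := exists_ne_zero_of_not_hasZeroFactor hzero p
    refine ⟨v p, hvp, fun w hw q hpq hws => (h ⟨w, hw, q, hpq, hws⟩).elim, fun hp w hw hwp => ?_⟩
    by_contra hne
    exact hp (isProtected_of_ne hw hv hwp hvp hne)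

/-- `L` is isotropic without vectors of weight one, its vectors of weight two are of the form
`z_p + z_q`, and it is nonzero at every qubit, being contained in the `z`-line at each
non-protected one. -/
structure ZAligned (L : Submodule (ZMod 2) (QV P)) : Prop where
  isotropic : Isotropic L
  exists_ne : ∀ v ∈ L, ∀ p, v p ≠ 0 → ∃ r, r ≠ p ∧ v r ≠ 0
  pair : ∀ v ∈ L, ∀ p q, p ≠ q → supp v = {p, q} → v = zvec p + zvec q
  gauge : ∀ p, ¬ IsProtected L p → ∀ v ∈ L, (v p).2 = 0
  exists_ne_zero : ∀ p, ∃ v ∈ L, v p ≠ 0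

theorem mem_mapL {f : P → (V ≃ₗ[ZMod 2] V)} {w : QV P} :
    w ∈ mapL L f ↔ ∃ v ∈ L, (fun p => f p (v p)) = w := Iff.rfl

theorem isProtected_mapL {f : P → (V ≃ₗ[ZMod 2] V)} {p : P} (h : IsProtected L p) :
    IsProtected (mapL L f) p := by
  intro w
  obtain ⟨v, hv, hvp⟩ := h ((f p).symm w)
  exact ⟨_, mem_mapL.2 ⟨v, hv, rfl⟩, by simp [hvp]⟩

theorem supp_map (f : P → (V ≃ₗ[ZMod 2] V)) (v : QV P) :
    supp (fun p => f p (v p)) = supp v := by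
  ext p
  simp [mem_supp]

theorem eq_zvec_add_zvec {v : QV P} {p q : P} (hpq : p ≠ q) (hp : v p = (1, 0))
    (hq : v q = (1, 0)) (h : ∀ r, r ≠ p → r ≠ q → v r = 0) : v = zvec p + zvec q := by
  ext1 r
  by_cases hrp : r = p
  · subst hrp
    simp [zvec, hp, Pi.single_eq_of_ne hpq]
  · by_cases hrq : r = q
    · subst hrq
      simp [zvec, hq, Pi.single_eq_of_ne hpq.symm]
    · simp [zvec, h r hrp hrq, Pi.single_eq_of_ne hrp, Pi.single_eq_of_ne hrq]

theorem exists_zAligned (hL : Isotropic L) (hzero : ¬ HasZeroFactor L)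
    (htriv : ¬ HasTrivialFactor L) (hbell : ¬ HasBellFactor L) :
    ∃ f : P → (V ≃ₗ[ZMod 2] V), IsLocalSymp f ∧ ZAligned (mapL L f) := by
  choose a ha0 hapair hagauge using exists_axis hL hzero htriv hbell
  choose f hf hfa using fun p => exists_symp_map_eq (ha0 p)
  refine ⟨f, hf, ?_, ?_, ?_, ?_, ?_⟩
  · rintro _ ⟨u, hu, rfl⟩ _ ⟨v, hv, rfl⟩
    rw [← hL u hu v hv]
    exact Finset.sum_congr rfl fun p _ => hf p _ _
  · rintro _ ⟨v, hv, rfl⟩ p hp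
    obtain ⟨r, hr, hvr⟩ := supp_ne_singleton hL htriv hv (p := p)
      (fun h => hp (by simp [h]))
    exact ⟨r, hr, by simpa using hvr⟩
  · intro w hw p q hpq hs
    obtain ⟨v, hv, rfl⟩ := mem_mapL.1 hw
    rw [supp_map] at hs
    have hs' := supp_eq_pair_iff.1 hs
    refine eq_zvec_add_zvec hpq ?_ ?_ fun r h1 h2 => ?_
    · rw [hapair p v hv q hpq hs, hfa]
    · rw [hapair q v hv p hpq.symm (by rw [hs, Set.pair_comm]), hfa]
    · rw [hs'.2.2 r h1 h2, map_zero]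
  · intro p hp w hw
    obtain ⟨v, hv, rfl⟩ := mem_mapL.1 hw
    by_cases h0 : v p = 0
    · simp [h0]
    · simp only [hagauge p (fun h => hp (isProtected_mapL h)) v hv h0, hfa]
  · intro p
    obtain ⟨v, hv, hvp⟩ := exists_ne_zero_of_not_hasZeroFactor hzero p
    exact ⟨_, mem_mapL.2 ⟨v, hv, rfl⟩, by simpa using hvp⟩

end Combinatorics

namespace ZAligned

variable {L : Submodule (ZMod 2) (QV P)}

theorem contig_iff (h : ZAligned L) {p q : P} : Contig L p q ↔ zvec p + zvec q ∈ L := by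
  constructor
  · rintro (rfl | ⟨v, hv, hs⟩)
    · rw [ZModModule.add_self]; exact L.zero_mem
    · by_cases hpq : p = q
      · subst hpq
        rw [ZModModule.add_self]; exact L.zero_mem
      · rw [← h.pair v hv p q hpq hs]; exact hv
  · intro hm
    by_cases hpq : p = q
    · exact .inl hpq
    · refine .inr ⟨_, hm, supp_eq_pair_iff.2 ⟨?_, ?_, fun r h1 h2 => ?_⟩⟩
      · simp [zvec, Pi.single_eq_of_ne hpq]
      · simp [zvec, Pi.single_eq_of_ne (Ne.symm hpq)]
      · simp [zvec, Pi.single_eq_of_ne h1, Pi.single_eq_of_ne h2]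

theorem contig_refl (p : P) : Contig L p p := .inl rfl

theorem contig_symm (h : ZAligned L) {p q : P} (hpq : Contig L p q) : Contig L q p := by
  rw [h.contig_iff] at hpq ⊢
  rwa [add_comm]

theorem contig_trans (h : ZAligned L) {p q r : P} (hpq : Contig L p q) (hqr : Contig L q r) :
    Contig L p r := by
  rw [h.contig_iff] at hpq hqr ⊢
  have := L.add_mem hpq hqr
  rwa [add_assoc, ← add_assoc (zvec q), ZModModule.add_self, zero_add] at this

/-- Contiguity as a setoid. -/
def setoid (h : ZAligned L) : Setoid P :=
  ⟨Contig L, contig_refl, h.contig_symm, h.contig_trans⟩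

/-- A chosen representative of the contiguity class of `p`. -/
def rep (h : ZAligned L) (p : P) : P := (Quotient.mk h.setoid p).out

theorem contig_rep (h : ZAligned L) (p : P) : Contig L (h.rep p) p :=
  Quotient.exact (s := h.setoid) (Quotient.out_eq (Quotient.mk h.setoid p))

theorem rep_eq_iff (h : ZAligned L) {p q : P} : h.rep p = h.rep q ↔ Contig L p q := by
  constructor
  · intro he
    exact h.contig_trans (h.contig_symm (h.contig_rep p)) (he ▸ h.contig_rep q)
  · intro hc
    exact congrArg Quotient.out (Quotient.sound (s := h.setoid) hc)

theorem rep_rep (h : ZAligned L) (p : P) : h.rep (h.rep p) = h.rep p :=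
  h.rep_eq_iff.2 (h.contig_rep p)

theorem snd_eq (h : ZAligned L) {p q : P} (hpq : Contig L p q) {v : QV P} (hv : v ∈ L) :
    (v p).2 = (v q).2 := by
  by_cases hne : p = q
  · rw [hne]
  have h0 := h.isotropic _ (h.contig_iff.1 hpq) v hv
  rw [omega_eq_pair hne (fun r h1 h2 => by
    simp [zvec, Pi.single_eq_of_ne h1, Pi.single_eq_of_ne h2])] at h0
  simp only [zvec, omegaV, Pi.add_apply, Pi.single_eq_same, Pi.single_eq_of_ne hne,
    Pi.single_eq_of_ne (Ne.symm hne), add_zero, zero_add, one_mul, zero_mul] at h0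
  exact CharTwo.add_eq_zero.1 h0

theorem isProtected_iff (h : ZAligned L) {p : P} :
    IsProtected L p ↔ ∃ v ∈ L, (v p).2 ≠ 0 := by
  constructor
  · intro hp
    obtain ⟨v, hv, hvp⟩ := hp (0, 1)
    exact ⟨v, hv, by simp [hvp]⟩
  · rintro ⟨v, hv, hvp⟩
    by_contra hp
    exact hvp (h.gauge p hp v hv)

theorem isProtected_congr (h : ZAligned L) {p q : P} (hpq : Contig L p q) :
    IsProtected L p ↔ IsProtected L q := by
  rw [h.isProtected_iff, h.isProtected_iff]
  exact exists_congr fun v => and_congr_right fun hv => by rw [h.snd_eq hpq hv]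

theorem exists_omegaV_ne_zero (h : ZAligned L) {p : P} {a : V} (ha : a ≠ 0)
    (hpa : a = (1, 0) → IsProtected L p) : ∃ v ∈ L, omegaV (v p) a ≠ 0 := by
  by_cases hp : IsProtected L p
  · have : ∀ a : V, a ≠ 0 → ∃ b, omegaV b a ≠ 0 := by decide
    obtain ⟨b, hb⟩ := this a ha
    obtain ⟨v, hv, rfl⟩ := hp b
    exact ⟨v, hv, hb⟩
  · obtain ⟨v, hv, hvp⟩ := h.exists_ne_zero p
    have h2 := h.gauge p hp v hv
    have key : ∀ a b : V, a ≠ 0 → a ≠ (1, 0) → b ≠ 0 → b.2 = 0 → omegaV b a ≠ 0 := by decide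
    exact ⟨v, hv, key a _ ha (fun h => hp (hpa h)) hvp h2⟩

theorem omega_single (v : QV P) (p : P) (a : V) :
    omega v (Pi.single p a) = omegaV (v p) a := by
  unfold omega
  rw [Finset.sum_eq_single p (fun r _ hr => by simp [Pi.single_eq_of_ne hr, omegaV]) (by simp)]
  simp

theorem weight_two_or_contig (h : ZAligned L) {p : P} {a : V} {v : QV P} (hv : v ∈ L)
    (hv0 : v ≠ 0) :
    (∃ q r, q ≠ r ∧ v q + (Pi.single p a : QV P) q ≠ 0 ∧ v r + (Pi.single p a : QV P) r ≠ 0) ∨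
      ∃ q, q ≠ p ∧ Contig L p q ∧ a = (1, 0) ∧ v q + (Pi.single p a : QV P) q = (1, 0) := by
  by_contra hc
  push Not at hc
  obtain ⟨hc1, hc2⟩ := hc
  have hq : ∃ q, q ≠ p ∧ v q ≠ 0 := by
    by_cases hp : v p = 0
    · obtain ⟨s, hs⟩ := Function.ne_iff.1 hv0
      exact ⟨s, fun h => hs (h ▸ hp), hs⟩
    · exact h.exists_ne v hv p hp
  obtain ⟨q, hqp, hvq⟩ := hq
  have hq0 : v q + (Pi.single p a : QV P) q ≠ 0 := by simpa [Pi.single_eq_of_ne hqp] using hvq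
  have hr : ∀ r, r ≠ q → v r + (Pi.single p a : QV P) r = 0 := fun r hrq =>
    hc1 q r hrq.symm hq0
  have hvp : v p = a := by
    have := hr p hqp.symm
    rw [Pi.single_eq_same] at this
    exact CharTwo.add_eq_zero.1 this
  have hr' : ∀ r, r ≠ p → r ≠ q → v r = 0 := fun r h1 h2 => by
    simpa [Pi.single_eq_of_ne h1] using hr r h2
  have hvp0 : v p ≠ 0 := by
    intro h0
    obtain ⟨s, hs, hvs⟩ := h.exists_ne v hv q hvq
    by_cases hsp : s = p
    · exact hvs (hsp ▸ h0)
    · exact hvs (hr' s hsp hs)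
  have hs : supp v = {p, q} := supp_eq_pair_iff.2 ⟨hvp0, hvq, hr'⟩
  have hveq := h.pair v hv p q hqp.symm hs
  have h1 : v p = (1, 0) := by rw [hveq]; simp [zvec, Pi.single_eq_of_ne hqp.symm]
  have h2 : v q = (1, 0) := by rw [hveq]; simp [zvec, Pi.single_eq_of_ne hqp]
  exact hc2 q hqp (.inr ⟨v, hv, hs⟩) (hvp ▸ h1) (by simpa [Pi.single_eq_of_ne hqp] using h2)

/-- Rigidity of small solutions of the coset equations of weight-one errors. -/
theorem eq_zero_of_coset_equations (h : ZAligned L) (r : P → V → ℂ) (hr0 : ∀ p, r p 0 = 1)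
    (s : P → V → QV P → ℂ) (hs : ∀ p a v, v ∈ L → ‖s p a v‖ = 1)
    (heq : ∀ p a, (∃ v ∈ L, omegaV (v p) a ≠ 0) →
      ∑ v with v ∈ L, s p a v * ∏ q, r q (v q + (Pi.single p a : QV P) q) = 0)
    (hz : ∀ p, ¬ (IsProtected L p ∧ h.rep p = p) → r p (1, 0) = 0)
    {ε : ℝ} (hε1 : ε < 1) (hε : Fintype.card (QV P) * ε < 1)
    (hr : ∀ p a, a ≠ 0 → ‖r p a‖ ≤ ε) : ∀ p a, a ≠ 0 → r p a = 0 := by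
  by_contra hc
  push Not at hc
  obtain ⟨p₀, a₀, ha₀, hne₀⟩ := hc
  obtain ⟨⟨p, a⟩, hpa, hmax⟩ := Finset.exists_max_image
    (Finset.univ.filter fun x : P × V => x.2 ≠ 0) (fun x => ‖r x.1 x.2‖)
    ⟨(p₀, a₀), by simpa using ha₀⟩
  simp only [Finset.mem_filter, Finset.mem_univ, true_and] at hpa hmax
  set M := ‖r p a‖ with hM
  have hmax' : ∀ q b, b ≠ 0 → ‖r q b‖ ≤ M := fun q b hb => hmax (q, b) hb
  have hMpos : 0 < M := (norm_pos_iff.2 hne₀).trans_le (hmax' p₀ a₀ ha₀)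
  have hMε : M ≤ ε := hr p a hpa
  have hle1 : ∀ q b, ‖r q b‖ ≤ 1 := fun q b => by
    by_cases hb : b = 0
    · rw [hb, hr0, norm_one]
    · exact (hr q b hb).trans hε1.le
  have hprot : a = (1, 0) → IsProtected L p ∧ h.rep p = p := by
    intro ha
    by_contra hn
    rw [hM, ha, hz p hn, norm_zero] at hMpos
    exact lt_irrefl _ hMpos
  have key := heq p a (h.exists_omegaV_ne_zero hpa fun ha => (hprot ha).1)
  have hmem0 : (0 : QV P) ∈ Finset.univ.filter fun v : QV P => v ∈ L := by simp
  rw [← Finset.add_sum_erase _ (fun v => s p a v * ∏ q, r q (v q + (Pi.single p a : QV P) q)) hmem0] at key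
  have hprod0 : ∏ q, r q ((0 : QV P) q + (Pi.single p a : QV P) q) = r p a := by
    rw [Finset.prod_eq_single p (fun q _ hq => ?_) (by simp)]
    · simp
    · simp [Pi.single_eq_of_ne hq, hr0]
  rw [hprod0] at key
  have hterm : ∀ v ∈ (Finset.univ.filter fun v : QV P => v ∈ L).erase 0,
      ‖s p a v * ∏ q, r q (v q + (Pi.single p a : QV P) q)‖ ≤ M * M := by
    intro v hv
    simp only [Finset.mem_erase, Finset.mem_filter, Finset.mem_univ, true_and] at hv
    rw [norm_mul, hs p a v hv.2, one_mul, norm_prod]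
    rcases h.weight_two_or_contig (p := p) (a := a) hv.2 hv.1 with
      ⟨q, q', hqq, hq, hq'⟩ | ⟨q, hqp, hcon, ha, hq⟩
    · rw [← Finset.mul_prod_erase _ _ (Finset.mem_univ q),
        ← Finset.mul_prod_erase _ _ (Finset.mem_erase.2 ⟨hqq.symm, Finset.mem_univ q'⟩),
        ← mul_assoc]
      refine (mul_le_of_le_one_right (by positivity)
        (Finset.prod_le_one (fun _ _ => norm_nonneg _) fun t _ => hle1 t _)).trans ?_
      exact mul_le_mul (hmax' _ _ hq) (hmax' _ _ hq') (norm_nonneg _) hMpos.le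
    · have hqr : h.rep q ≠ q := by
        rw [← h.rep_eq_iff.2 hcon, (hprot ha).2]
        exact hqp.symm
      rw [Finset.prod_eq_zero (Finset.mem_univ q)]
      · positivity
      · rw [hq, hz q (fun hh => hqr hh.2), norm_zero]
  have h1 : M ≤ Fintype.card (QV P) * (M * M) := by
    have e1 : s p a 0 * r p a =
        -∑ v ∈ (Finset.univ.filter fun v : QV P => v ∈ L).erase 0,
          s p a v * ∏ q, r q (v q + (Pi.single p a : QV P) q) := eq_neg_of_add_eq_zero_left key
    have e2 : M = ‖s p a 0 * r p a‖ := by rw [norm_mul, hs p a 0 L.zero_mem, one_mul]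
    rw [e1, norm_neg] at e2
    refine e2.le.trans ((norm_sum_le_of_le _ hterm).trans ?_)
    rw [Finset.sum_const, nsmul_eq_mul]
    refine mul_le_mul_of_nonneg_right ?_ (mul_self_nonneg M)
    exact_mod_cast Finset.card_le_univ _
  have h2 : (Fintype.card (QV P) : ℝ) * M < 1 :=
    (mul_le_mul_of_nonneg_left hMε (by positivity)).trans_lt hε
  nlinarith

end ZAligned

theorem forall_zmod_two {p : ZMod 2 → Prop} (h0 : p 0) (h1 : p 1) (a : ZMod 2) : p a := by
  fin_cases a
  exacts [h0, h1]

/-- The sign character of `𝔽₂`. -/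
def sgn (a : ZMod 2) : ℂ := (-1) ^ a.val

theorem sgn_add (a b : ZMod 2) : sgn (a + b) = sgn a * sgn b := by
  have h11 : (1 + 1 : ZMod 2) = 0 := rfl
  revert a b
  refine forall_zmod_two (forall_zmod_two ?_ ?_) (forall_zmod_two ?_ ?_) <;>
  simp [sgn, ZMod.val_one, h11]

theorem sgn_zero : sgn 0 = 1 := by simp [sgn]

theorem sgn_of_ne_zero {a : ZMod 2} (ha : a ≠ 0) : sgn a = -1 := by
  have : a = 1 := by revert a; decide
  subst this
  simp [sgn, ZMod.val_one]

theorem norm_sgn (a : ZMod 2) : ‖sgn a‖ = 1 := by simp [sgn]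

theorem sgn_sum {ι : Type} (s : Finset ι) (a : ι → ZMod 2) :
    sgn (∑ i ∈ s, a i) = ∏ i ∈ s, sgn (a i) := by
  induction s using Finset.induction_on with
  | empty => simp [sgn_zero]
  | insert i s hi ih => rw [Finset.sum_insert hi, Finset.prod_insert hi, sgn_add, ih]

theorem locOp_mul (a b : P → Matrix (Fin 2) (Fin 2) ℂ) :
    locOp a * locOp b = locOp fun p => a p * b p := by
  ext x z
  simp only [locOp, Matrix.mul_apply, Matrix.of_apply, ← Finset.prod_mul_distrib]
  rw [Finset.prod_univ_sum, Fintype.piFinset_univ]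

theorem trace_locOp (a : P → Matrix (Fin 2) (Fin 2) ℂ) :
    (locOp a).trace = ∏ p, (a p).trace := by
  simp only [locOp, Matrix.trace, Matrix.diag_apply, Matrix.of_apply]
  rw [Finset.prod_univ_sum, Fintype.piFinset_univ]

theorem locOp_smul (c : P → ℂ) (a : P → Matrix (Fin 2) (Fin 2) ℂ) :
    locOp (fun p => c p • a p) = (∏ p, c p) • locOp a := by
  ext x z
  simp [locOp, Finset.prod_mul_distrib]

theorem locOp_one : locOp (fun _ : P => (1 : Matrix (Fin 2) (Fin 2) ℂ)) = 1 := by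
  ext x z
  simp only [locOp, Matrix.of_apply, Matrix.one_apply]
  by_cases h : x = z
  · simp [h]
  · rw [if_neg h]
    obtain ⟨p, hp⟩ := Function.ne_iff.1 h
    exact Finset.prod_eq_zero (Finset.mem_univ p) (if_neg hp)

theorem star_locOp (a : P → Matrix (Fin 2) (Fin 2) ℂ) :
    star (locOp a) = locOp fun p => star (a p) := by
  ext x z
  simp [locOp, Matrix.star_apply]

theorem pauliMat_mul (v w : V) :
    pauliMat v * pauliMat w = sgn (v.2 * w.1) • pauliMat (v + w) := by
  obtain ⟨a, b⟩ := v
  obtain ⟨c, d⟩ := w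
  have h11 : (1 + 1 : ZMod 2) = 0 := rfl
  revert a b c d
  refine forall_zmod_two (forall_zmod_two ?_ ?_) (forall_zmod_two ?_ ?_) <;>
  refine forall_zmod_two (forall_zmod_two ?_ ?_) (forall_zmod_two ?_ ?_) <;>
  · ext i j
    fin_cases i <;> fin_cases j <;>
    simp [pauliMat, sgn, sigmaX, sigmaZ, ZMod.val_one, h11, Matrix.mul_apply, Fin.sum_univ_two]

theorem pauliMat_zero : pauliMat 0 = 1 := by simp [pauliMat]

theorem pauliMat_mem_unitaryGroup (v : V) :
    pauliMat v ∈ Matrix.unitaryGroup (Fin 2) ℂ := by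
  have hz : sigmaZ ∈ Matrix.unitaryGroup (Fin 2) ℂ := by
    rw [Matrix.mem_unitaryGroup_iff]
    ext i j
    fin_cases i <;> fin_cases j <;>
    simp [sigmaZ, Matrix.mul_apply, Matrix.star_apply, Fin.sum_univ_two]
  have hx : sigmaX ∈ Matrix.unitaryGroup (Fin 2) ℂ := by
    rw [Matrix.mem_unitaryGroup_iff]
    ext i j
    fin_cases i <;> fin_cases j <;>
    simp [sigmaX, Matrix.mul_apply, Matrix.star_apply, Fin.sum_univ_two]
  exact mul_mem (pow_mem hz _) (pow_mem hx _)

theorem eq_iff_of_pauliMat_ne_zero {v : V} {i j : Fin 2} (h : pauliMat v i j ≠ 0) :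
    i = j ↔ v.2 = 0 := by
  obtain ⟨a, b⟩ := v
  revert a b
  refine forall_zmod_two (forall_zmod_two ?_ ?_) (forall_zmod_two ?_ ?_) <;>
  · fin_cases i <;> fin_cases j <;>
    simp [pauliMat, sigmaX, sigmaZ, ZMod.val_one, Matrix.mul_apply, Fin.sum_univ_two]

/-- The bilinear form computing the cocycle of the Pauli operators. -/
def cocycle (v w : QV P) : ZMod 2 := ∑ p, (v p).2 * (w p).1

theorem omega_eq_cocycle (v w : QV P) : omega v w = cocycle w v + cocycle v w := by
  simp only [omega, omegaV, cocycle, ← Finset.sum_add_distrib]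
  exact Finset.sum_congr rfl fun p _ => by rw [mul_comm (v p).1]

theorem Wop_mul (v w : QV P) : Wop v * Wop w = sgn (cocycle v w) • Wop (v + w) := by
  simp only [Wop, locOp_mul, pauliMat_mul, locOp_smul, cocycle, sgn_sum, Pi.add_apply]

theorem Wop_mul_comm (v w : QV P) : Wop v * Wop w = sgn (omega v w) • (Wop w * Wop v) := by
  rw [Wop_mul, Wop_mul, smul_smul, add_comm w v]
  congr 1
  rw [omega_eq_cocycle, add_comm, sgn_add, mul_assoc, ← sgn_add, ZModModule.add_self, sgn_zero,
    mul_one]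

theorem Wop_zero : Wop (0 : QV P) = 1 := by
  simp only [Wop, Pi.zero_apply, pauliMat_zero, locOp_one]

theorem Wop_mem_unitaryGroup (v : QV P) : Wop v ∈ Matrix.unitaryGroup (P → Fin 2) ℂ := by
  rw [Matrix.mem_unitaryGroup_iff, Wop, star_locOp, locOp_mul]
  simp only [Matrix.mem_unitaryGroup_iff.1 (pauliMat_mem_unitaryGroup _), locOp_one]

theorem Wop_mul_self (v : QV P) : Wop v * Wop v = sgn (cocycle v v) • 1 := by
  rw [Wop_mul, ZModModule.add_self, Wop_zero]

section Section

variable {L : Submodule (ZMod 2) (QV P)}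

theorem Wop_mulVec_single_of_snd_eq_zero {v : QV P} (hv : ∀ p, (v p).2 = 0) :
    Wop v *ᵥ Pi.single 0 1 = Pi.single 0 1 := by
  rw [Matrix.mulVec_single_one]
  ext x
  have hp : ∀ a : ZMod 2, ∀ i : Fin 2, pauliMat (a, 0) i 0 = if i = 0 then 1 else 0 :=
    forall_zmod_two (fun i => by fin_cases i <;> simp [pauliMat])
      (fun i => by fin_cases i <;> simp [pauliMat, sigmaZ, ZMod.val_one])
  have : ∀ p, pauliMat (v p) (x p) 0 = if x p = 0 then 1 else 0 := fun p => by
    rw [← hp (v p).1, ← hv p]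
  simp only [Matrix.col_apply, Wop, locOp, Matrix.of_apply, Pi.zero_apply, this, Pi.single_apply]
  by_cases h : x = 0
  · simp [h]
  · rw [if_neg h]
    obtain ⟨p, hp⟩ := Function.ne_iff.1 h
    exact Finset.prod_eq_zero (Finset.mem_univ p) (if_neg hp)

theorem Wop_mulVec_comm (hL : Isotropic L) {u v : QV P} (hu : u ∈ L) (hv : v ∈ L) (ψ : HP P) :
    Wop u *ᵥ (Wop v *ᵥ ψ) = Wop v *ᵥ (Wop u *ᵥ ψ) := by
  rw [Matrix.mulVec_mulVec, Matrix.mulVec_mulVec, Wop_mul_comm, hL u hu v hv, sgn_zero, one_smul]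

/-- The Pauli operators over an isotropic subspace have a common eigenvector that is fixed by
those of `Z`-type. -/
theorem exists_common_eigenvector (hL : Isotropic L) :
    ∃ ψ : HP P, ψ ≠ 0 ∧ (∀ v ∈ L, ∃ μ : ℂ, Wop v *ᵥ ψ = μ • ψ) ∧
      ∀ v ∈ L, (∀ p, (v p).2 = 0) → Wop v *ᵥ ψ = ψ := by
  let F : Set (Submodule ℂ (HP P)) := {K | K ≠ ⊥ ∧ (∀ v ∈ L, ∀ ψ ∈ K, Wop v *ᵥ ψ ∈ K) ∧
    ∀ v ∈ L, (∀ p, (v p).2 = 0) → ∀ ψ ∈ K, Wop v *ᵥ ψ = ψ}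
  let K₀ : Submodule ℂ (HP P) :=
    { carrier := {ψ | ∀ v ∈ L, (∀ p, (v p).2 = 0) → Wop v *ᵥ ψ = ψ}
      add_mem' := fun ha hb v hv h => by rw [Matrix.mulVec_add, ha v hv h, hb v hv h]
      zero_mem' := fun v _ _ => by simp
      smul_mem' := fun c a ha v hv h => by rw [Matrix.mulVec_smul, ha v hv h] }
  have hF : F.Nonempty := by
    refine ⟨K₀, fun h => ?_, fun v hv ψ hψ w hw h => ?_, fun v hv h ψ hψ => hψ v hv h⟩
    · have hm : (Pi.single 0 1 : HP P) ∈ K₀ := fun v _ h => Wop_mulVec_single_of_snd_eq_zero h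
      rw [h, Submodule.mem_bot] at hm
      simpa using congrFun hm 0
    · rw [Wop_mulVec_comm hL hw hv, hψ w hw h]
  obtain ⟨K, ⟨hK0, hKinv, hKfix⟩, hmin⟩ :=
    (wellFounded_lt (α := Submodule ℂ (HP P))).has_min F hF
  have hscal : ∀ v ∈ L, ∃ μ : ℂ, ∀ ψ ∈ K, Wop v *ᵥ ψ = μ • ψ := by
    intro v hv
    have : Nontrivial K := Submodule.nontrivial_iff_ne_bot.2 hK0
    let T : K →ₗ[ℂ] K := (Matrix.mulVecLin (Wop v)).restrict (hKinv v hv)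
    obtain ⟨μ, hμ⟩ := Module.End.exists_eigenvalue T
    obtain ⟨x, hx⟩ := hμ.exists_hasEigenvector
    have hxe : Wop v *ᵥ (x : HP P) = μ • (x : HP P) := congrArg Subtype.val hx.apply_eq_smul
    let K' : Submodule ℂ (HP P) :=
      { carrier := {ψ | ψ ∈ K ∧ Wop v *ᵥ ψ = μ • ψ}
        add_mem' := fun ha hb => ⟨K.add_mem ha.1 hb.1, by
          rw [Matrix.mulVec_add, ha.2, hb.2, smul_add]⟩
        zero_mem' := ⟨K.zero_mem, by simp⟩
        smul_mem' := fun c a ha => ⟨K.smul_mem c ha.1, by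
          rw [Matrix.mulVec_smul, ha.2, smul_comm]⟩ }
    have hle : K' ≤ K := fun ψ hψ => hψ.1
    have hK' : K' ∈ F := by
      refine ⟨fun h => ?_, fun w hw ψ hψ => ⟨hKinv w hw ψ hψ.1, ?_⟩,
        fun w hw h ψ hψ => hKfix w hw h ψ hψ.1⟩
      · have hm : (x : HP P) ∈ K' := ⟨x.2, hxe⟩
        rw [h, Submodule.mem_bot] at hm
        exact hx.2 (Subtype.ext hm)
      · rw [Wop_mulVec_comm hL hv hw, hψ.2, Matrix.mulVec_smul]
    have heq : K' = K := (eq_or_lt_of_le hle).resolve_right (hmin K' hK')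
    exact ⟨μ, fun ψ hψ => (heq ▸ hψ : ψ ∈ K').2⟩
  obtain ⟨ψ, hψ, hψ0⟩ := Submodule.exists_mem_ne_zero_of_ne_bot hK0
  refine ⟨ψ, hψ0, fun v hv => ?_, fun v hv h => hKfix v hv h ψ hψ⟩
  obtain ⟨μ, hμ⟩ := hscal v hv
  exact ⟨μ, hμ ψ hψ⟩

theorem smul_mem_unitaryGroup_iff {n : Type} [Fintype n] [DecidableEq n] [Nonempty n]
    {A : Matrix n n ℂ} (hA : A ∈ Matrix.unitaryGroup n ℂ) {c : ℂ} :
    c • A ∈ Matrix.unitaryGroup n ℂ ↔ ‖c‖ = 1 := by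
  rw [Matrix.mem_unitaryGroup_iff, star_smul, smul_mul_smul_comm,
    Matrix.mem_unitaryGroup_iff.1 hA]
  have h1 : c * star c = ((‖c‖ ^ 2 : ℝ) : ℂ) := by
    rw [← Complex.normSq_eq_norm_sq, ← Complex.mul_conj]; rfl
  rw [h1]
  constructor
  · intro h
    obtain ⟨i⟩ := ‹Nonempty n›
    have := congrFun (congrFun h i) i
    simp only [Matrix.smul_apply, Matrix.one_apply_eq, smul_eq_mul, mul_one] at this
    have h2 : ‖c‖ ^ 2 = 1 := by exact_mod_cast this
    exact (pow_eq_one_iff_of_nonneg (norm_nonneg c) two_ne_zero).1 h2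
  · intro h
    rw [h]; simp

/-- Every isotropic subspace has a section taking the standard values on vectors of
`Z`-type. -/
theorem exists_section (hL : Isotropic L) :
    ∃ σ : PauliSection L, ∀ v ∈ L, (∀ p, (v p).2 = 0) → σ.toFun v = Wop v := by
  obtain ⟨ψ, hψ0, heig, hfix⟩ := exists_common_eigenvector hL
  have heig' : ∀ v, ∃ μ : ℂ, v ∈ L → Wop v *ᵥ ψ = μ • ψ := fun v => by
    by_cases hv : v ∈ L
    · exact (heig v hv).imp fun μ hμ _ => hμ
    · exact ⟨0, fun h => (hv h).elim⟩
  choose μ hμ using heig'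
  have hinj : ∀ {a b : ℂ}, a • ψ = b • ψ → a = b := fun h => smul_left_injective ℂ hψ0 h
  have hsq : ∀ v ∈ L, μ v * μ v = sgn (cocycle v v) := fun v hv => hinj <| by
    rw [mul_smul, ← hμ v hv, ← Matrix.mulVec_smul, ← hμ v hv, Matrix.mulVec_mulVec, Wop_mul_self,
      Matrix.smul_mulVec, Matrix.one_mulVec]
  have hnorm : ∀ v ∈ L, ‖μ v‖ = 1 := fun v hv => by
    have := congrArg norm (hsq v hv)
    rw [norm_mul, norm_sgn, ← sq] at this
    exact (pow_eq_one_iff_of_nonneg (norm_nonneg _) two_ne_zero).1 this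
  have hne : ∀ v ∈ L, μ v ≠ 0 := fun v hv h => by simpa [h] using hnorm v hv
  have hmul : ∀ u ∈ L, ∀ v ∈ L, μ u * μ v = sgn (cocycle u v) * μ (u + v) :=
    fun u hu v hv => hinj <| by
      rw [mul_smul (sgn _), ← hμ _ (L.add_mem hu hv), ← Matrix.smul_mulVec, ← Wop_mul,
        ← Matrix.mulVec_mulVec, hμ v hv, Matrix.mulVec_smul, hμ u hu, smul_smul, mul_comm]
  have hZ : ∀ v ∈ L, (∀ p, (v p).2 = 0) → μ v = 1 := fun v hv h => hinj <| by
    rw [← hμ v hv, hfix v hv h, one_smul]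
  refine ⟨⟨fun v => if v ∈ L then (μ v)⁻¹ • Wop v else Wop v, fun v => ?_, fun v => ?_,
    fun u hu v hv => ?_, ?_⟩, fun v hv h => ?_⟩
  · by_cases hv : v ∈ L
    · exact ⟨_, if_pos hv⟩
    · exact ⟨1, by rw [if_neg hv, one_smul]⟩
  · by_cases hv : v ∈ L
    · simp only [if_pos hv]
      rw [smul_mem_unitaryGroup_iff (Wop_mem_unitaryGroup v), norm_inv, hnorm v hv, inv_one]
    · simp only [if_neg hv]
      exact Wop_mem_unitaryGroup v
  · simp only [if_pos hu, if_pos hv, if_pos (L.add_mem hu hv)]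
    rw [smul_mul_smul_comm, Wop_mul, smul_smul]
    congr 1
    have h1 := hmul u hu v hv
    have h2 := hne u hu
    have h3 := hne v hv
    have h4 := hne _ (L.add_mem hu hv)
    field_simp
    rw [h1, mul_comm]
  · simp only [if_pos L.zero_mem]
    rw [hZ 0 L.zero_mem fun _ => rfl, inv_one, one_smul, Wop_zero]
  · simp only [if_pos hv]
    rw [hZ v hv h, inv_one, one_smul]

end Section

section Code

variable {L : Submodule (ZMod 2) (QV P)}

theorem exists_scalar (σ : PauliSection L) (v : QV P) :
    ∃ c : ℂ, ‖c‖ = 1 ∧ σ.toFun v = c • Wop v := by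
  obtain ⟨c, hc⟩ := σ.scalar v
  have h := σ.unitary v
  rw [hc, smul_mem_unitaryGroup_iff (Wop_mem_unitaryGroup v)] at h
  exact ⟨c, h, hc⟩

/-- The sum of the stabilizer group, a multiple of the projection to the code. -/
def stabSum (σ : PauliSection L) : MatP P := ∑ v with v ∈ L, σ.toFun v

theorem mul_stabSum (σ : PauliSection L) {v : QV P} (hv : v ∈ L) :
    σ.toFun v * stabSum σ = stabSum σ := by
  rw [stabSum, Finset.mul_sum]
  refine Finset.sum_nbij' (v + ·) (v + ·) ?_ ?_ ?_ ?_ ?_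
  · simpa using fun w hw => L.add_mem hv hw
  · simpa using fun w hw => L.add_mem hv hw
  · intro w _
    simp only [← add_assoc, ZModModule.add_self, zero_add]
  · intro w _
    simp only [← add_assoc, ZModModule.add_self, zero_add]
  · intro w hw
    rw [σ.mul_of_mem v hv w (by simpa using hw)]

theorem stabSum_mul (σ : PauliSection L) {v : QV P} (hv : v ∈ L) :
    stabSum σ * σ.toFun v = stabSum σ := by
  rw [stabSum, Finset.sum_mul]
  refine Finset.sum_nbij' (· + v) (· + v) ?_ ?_ ?_ ?_ ?_
  · simpa using fun w hw => L.add_mem hw hv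
  · simpa using fun w hw => L.add_mem hw hv
  · intro w _
    simp only [add_assoc, ZModModule.add_self, add_zero]
  · intro w _
    simp only [add_assoc, ZModModule.add_self, add_zero]
  · intro w hw
    rw [σ.mul_of_mem w (by simpa using hw) v hv]

theorem mul_mul_stabSum_of_preserves (σ : PauliSection L) {U : MatP P}
    (hU : ∀ ψ ∈ code L σ, U *ᵥ ψ ∈ code L σ) {v : QV P} (hv : v ∈ L) :
    σ.toFun v * (U * stabSum σ) = U * stabSum σ := by
  refine Matrix.ext_of_mulVec_single fun i => ?_
  have h1 : stabSum σ *ᵥ Pi.single i 1 ∈ code L σ := fun w hw => by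
    rw [Matrix.mulVec_mulVec, mul_stabSum σ hw]
  have h2 := hU _ h1 v hv
  simpa only [Matrix.mulVec_mulVec, mul_assoc] using h2

theorem trace_mul_stabSum_eq_zero (σ : PauliSection L) {U : MatP P}
    (hU : ∀ ψ ∈ code L σ, U *ᵥ ψ ∈ code L σ) {v w : QV P} (hv : v ∈ L) (hw : omega v w ≠ 0) :
    (U * stabSum σ * Wop w).trace = 0 := by
  obtain ⟨c, -, hc⟩ := exists_scalar σ v
  have hcomm : Wop w * σ.toFun v = -(σ.toFun v * Wop w) := by
    rw [hc, mul_smul_comm, smul_mul_assoc, Wop_mul_comm v w, sgn_of_ne_zero hw, neg_one_smul,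
      smul_neg, neg_neg]
  have key : (U * stabSum σ * Wop w).trace = -(U * stabSum σ * Wop w).trace := by
    conv_lhs => rw [← mul_mul_stabSum_of_preserves σ hU hv, mul_assoc, Matrix.trace_mul_comm,
      mul_assoc, hcomm, mul_neg, Matrix.trace_neg, mul_assoc, ← mul_assoc (stabSum σ),
      stabSum_mul σ hv, ← mul_assoc]
  exact self_eq_neg.1 key

/-- The coset equation at an error `w` detected by the stabilizer group. -/
theorem coset_equation (σ : PauliSection L) {u : P → Matrix (Fin 2) (Fin 2) ℂ}
    (hU : ∀ ψ ∈ code L σ, locOp u *ᵥ ψ ∈ code L σ) (w : QV P) :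
    ∃ s : QV P → ℂ, (∀ v, ‖s v‖ = 1) ∧ ((∃ v ∈ L, omega v w ≠ 0) →
      ∑ v with v ∈ L, s v * ∏ q, (u q * pauliMat (v q + w q)).trace = 0) := by
  choose c hc hσ using exists_scalar σ
  refine ⟨fun v => c v * sgn (cocycle v w), fun v => by rw [norm_mul, hc, norm_sgn, one_mul],
    fun ⟨v₀, hv₀, hw⟩ => ?_⟩
  rw [← trace_mul_stabSum_eq_zero σ hU hv₀ hw, stabSum, Finset.mul_sum, Finset.sum_mul,
    Matrix.trace_sum]
  refine Finset.sum_congr rfl fun v _ => ?_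
  rw [hσ, mul_smul_comm, smul_mul_assoc, mul_assoc (locOp u), Wop_mul, mul_smul_comm, smul_smul,
    Matrix.trace_smul, Wop, locOp_mul, trace_locOp, smul_eq_mul]
  rfl

/-- The phase gate `diag(1, z)`. -/
def phaseMat (z : Circle) : Matrix (Fin 2) (Fin 2) ℂ := !![1, 0; 0, (z : ℂ)]

theorem locOp_phaseMat (z : P → Circle) :
    locOp (fun p => phaseMat (z p)) =
      Matrix.diagonal fun x => ∏ p, if x p = 0 then (1 : ℂ) else z p := by
  ext x y
  have hent : ∀ p, ∀ i j : Fin 2, phaseMat (z p) i j =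
      if i = j then (if i = 0 then (1 : ℂ) else z p) else 0 := fun p i j => by
    fin_cases i <;> fin_cases j <;> simp [phaseMat]
  simp only [locOp, Matrix.of_apply, hent, Matrix.diagonal_apply]
  by_cases h : x = y
  · simp [h]
  · rw [if_neg h]
    obtain ⟨p, hp⟩ := Function.ne_iff.1 h
    exact Finset.prod_eq_zero (Finset.mem_univ p) (if_neg hp)

theorem eq_iff_of_Wop_ne_zero {v : QV P} {x y : P → Fin 2} (h : Wop v x y ≠ 0) (p : P) :
    x p = y p ↔ (v p).2 = 0 :=
  eq_iff_of_pauliMat_ne_zero fun h0 => h (Finset.prod_eq_zero (Finset.mem_univ p) h0)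

theorem Wop_zvec_add_zvec_apply {p q : P} (hpq : p ≠ q) (y : P → Fin 2) (hy : y p ≠ y q) :
    Wop (zvec p + zvec q) y y = -1 := by
  simp only [Wop, locOp, Matrix.of_apply]
  rw [Finset.prod_eq_mul p q hpq (fun r _ hr => ?_) (by simp) (by simp)]
  · have h1 : (zvec p + zvec q) p = (1, 0) := by simp [zvec, Pi.single_eq_of_ne hpq]
    have h2 : (zvec p + zvec q) q = (1, 0) := by simp [zvec, Pi.single_eq_of_ne hpq.symm]
    rw [h1, h2]
    generalize y p = i at hy
    generalize y q = j at hy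
    revert hy
    fin_cases i <;> fin_cases j <;> simp [pauliMat, sigmaZ, ZMod.val_one]
  · have h1 : (zvec p + zvec q) r = 0 := by
      simp [zvec, Pi.single_eq_of_ne hr.1, Pi.single_eq_of_ne hr.2]
    rw [h1, pauliMat_zero, Matrix.one_apply_eq]

theorem Wop_mulVec_apply_of_snd_eq_zero {v : QV P} (hv : ∀ p, (v p).2 = 0) (ψ : HP P)
    (y : P → Fin 2) : (Wop v *ᵥ ψ) y = Wop v y y * ψ y := by
  rw [Matrix.mulVec, dotProduct]
  refine Finset.sum_eq_single y (fun x _ hx => ?_) (by simp)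
  by_contra h
  exact hx (funext fun p =>
    ((eq_iff_of_Wop_ne_zero (left_ne_zero_of_mul h) p).2 (hv p)).symm)

namespace ZAligned

theorem apply_eq_of_mem_code (h : ZAligned L) {σ : PauliSection L}
    (hσ : ∀ v ∈ L, (∀ p, (v p).2 = 0) → σ.toFun v = Wop v) {ψ : HP P} (hψ : ψ ∈ code L σ)
    {y : P → Fin 2} (hy : ψ y ≠ 0) {p q : P} (hpq : Contig L p q) : y p = y q := by
  by_cases hne : p = q
  · rw [hne]
  by_contra hyne
  have hm := h.contig_iff.1 hpq
  have hz : ∀ r, ((zvec p + zvec q : QV P) r).2 = 0 := fun r => by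
    simp only [zvec, Pi.add_apply, Pi.single_apply]
    split_ifs <;> rfl
  have h1 := congrFun (hψ _ hm) y
  rw [hσ _ hm hz, Wop_mulVec_apply_of_snd_eq_zero hz, Wop_zvec_add_zvec_apply hne y hyne] at h1
  exact hy (self_eq_neg.1 (by rw [← neg_one_mul]; exact h1.symm))

theorem prod_protected_eq_one (h : ZAligned L) {z : P → Circle}
    (hz : ∀ p, IsProtected L p → ∏ q with Contig L p q, z q = 1) {x : P → Fin 2}
    (hx : ∀ p q, IsProtected L p → Contig L p q → x p = x q) :
    ∏ p with IsProtected L p, (if x p = 0 then 1 else z p) = 1 := by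
  rw [← Finset.prod_fiberwise_of_maps_to (g := h.rep)
    (t := Finset.univ.filter fun p => IsProtected L p)]
  · refine Finset.prod_eq_one fun p hp => ?_
    simp only [Finset.mem_filter, Finset.mem_univ, true_and] at hp
    by_cases hrp : h.rep p = p
    · have hset : ((Finset.univ.filter fun q => IsProtected L q).filter fun q => h.rep q = p) =
          Finset.univ.filter fun q => Contig L p q := by
        ext q
        simp only [Finset.mem_filter, Finset.mem_univ, true_and]
        constructor
        · rintro ⟨-, hq⟩
          rw [← h.rep_eq_iff, hrp, hq]
        · intro hc
          exact ⟨(h.isProtected_congr hc).1 hp, by rw [← h.rep_eq_iff.2 hc, hrp]⟩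
      rw [hset]
      by_cases hx0 : x p = 0
      · refine Finset.prod_eq_one fun q hq => if_pos ?_
        rw [← hx p q hp (by simpa using hq), hx0]
      · rw [← hz p hp]
        refine Finset.prod_congr rfl fun q hq => if_neg ?_
        rwa [← hx p q hp (by simpa using hq)]
    · refine Finset.prod_eq_one fun q hq => ?_
      simp only [Finset.mem_filter, Finset.mem_univ, true_and] at hq
      exact (hrp (by rw [← hq.2, h.rep_rep])).elim
  · intro p hp
    simp only [Finset.mem_filter, Finset.mem_univ, true_and] at hp ⊢
    exact (h.isProtected_congr (h.contig_rep p)).2 hp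

theorem locOp_phaseMat_mem_code (h : ZAligned L) {σ : PauliSection L}
    (hσ : ∀ v ∈ L, (∀ p, (v p).2 = 0) → σ.toFun v = Wop v) {z : P → Circle}
    (hz : ∀ p, IsProtected L p → ∏ q with Contig L p q, z q = 1) {ψ : HP P}
    (hψ : ψ ∈ code L σ) : locOp (fun p => phaseMat (z p)) *ᵥ ψ ∈ code L σ := by
  intro v hv
  rw [locOp_phaseMat]
  set d : (P → Fin 2) → ℂ := fun x => ∏ p, if x p = 0 then (1 : ℂ) else z p with hd
  have hdeq : ∀ x : P → Fin 2, (∀ p q, IsProtected L p → Contig L p q → x p = x q) →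
      d x = ∏ p with ¬ IsProtected L p, if x p = 0 then (1 : ℂ) else z p := fun x hx => by
    simp only [hd]
    rw [← Finset.prod_filter_mul_prod_filter_not Finset.univ fun p => IsProtected L p]
    have h1 := congrArg Circle.coeHom (h.prod_protected_eq_one hz hx)
    rw [map_prod, map_one] at h1
    have h2 : ∀ p, Circle.coeHom (if x p = 0 then 1 else z p) =
        if x p = 0 then (1 : ℂ) else z p := fun p => by
      split_ifs
      exacts [map_one _, rfl]
    simp only [h2] at h1
    rw [h1, one_mul]
  have key : ∀ x y, σ.toFun v x y ≠ 0 → ψ y ≠ 0 → d y = d x := by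
    intro x y hxy hy
    obtain ⟨c, -, hc⟩ := exists_scalar σ v
    have hW : Wop v x y ≠ 0 := fun h0 => hxy (by rw [hc, Matrix.smul_apply, h0, smul_zero])
    have hyc : ∀ p q, Contig L p q → y p = y q := fun p q hpq =>
      h.apply_eq_of_mem_code hσ hψ hy hpq
    have hxc : ∀ p q, Contig L p q → x p = x q := fun p q hpq => by
      have h1 := eq_iff_of_Wop_ne_zero hW p
      have h2 := eq_iff_of_Wop_ne_zero hW q
      rw [h.snd_eq hpq hv, ← h2, hyc p q hpq] at h1
      generalize x p = a at *
      generalize x q = b at *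
      generalize y q = e at *
      revert h1
      fin_cases a <;> fin_cases b <;> fin_cases e <;> simp
    rw [hdeq y fun p q _ => hyc p q, hdeq x fun p q _ => hxc p q]
    refine Finset.prod_congr rfl fun p hp => ?_
    rw [(eq_iff_of_Wop_ne_zero hW p).2 (h.gauge p (by simpa using hp) v hv)]
  ext x
  rw [Matrix.mulVec_diagonal, ← congrFun (hψ v hv) x, Matrix.mulVec, Matrix.mulVec, dotProduct,
    dotProduct, Finset.mul_sum]
  refine Finset.sum_congr rfl fun y _ => ?_
  rw [Matrix.mulVec_diagonal]
  by_cases hxy : σ.toFun v x y = 0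
  · simp [hxy]
  · by_cases hy : ψ y = 0
    · simp [hy]
    · rw [key x y hxy hy]; ring

end ZAligned

end Code

/-- The rotation about the `z`-axis attached to a point of the circle. -/
def rotC (z : Circle) : Rot :=
  !![(z : ℂ).re, -(z : ℂ).im, 0; (z : ℂ).im, (z : ℂ).re, 0; 0, 0, 1]

theorem rotZ_eq_rotC (θ : ℝ) : rotZ θ = rotC (Circle.exp θ) := by
  simp [rotZ, rotC, Complex.exp_ofReal_mul_I_re, Complex.exp_ofReal_mul_I_im]

theorem rotC_one : rotC 1 = 1 := by
  ext i j
  fin_cases i <;> fin_cases j <;> simp [rotC]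

theorem rotC_mul (z w : Circle) : rotC (z * w) = rotC z * rotC w := by
  ext i j
  fin_cases i <;> fin_cases j <;>
    simp [rotC, Matrix.mul_apply, Fin.sum_univ_three] <;> ring

theorem rotC_injective : Function.Injective rotC := by
  intro z w h
  have h0 := congrFun (congrFun h 0) 0
  have h1 := congrFun (congrFun h 1) 0
  simp only [rotC, Matrix.of_apply, Matrix.cons_val', Matrix.cons_val_zero,
    Matrix.cons_val_one] at h0 h1
  exact Circle.ext (Complex.ext h0 h1)

theorem continuous_rotC : Continuous rotC := by
  refine continuous_matrix fun i j => ?_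
  have h1 : Continuous fun z : Circle => (z : ℂ).re :=
    Complex.continuous_re.comp continuous_subtype_val
  have h2 : Continuous fun z : Circle => (z : ℂ).im :=
    Complex.continuous_im.comp continuous_subtype_val
  fin_cases i <;> fin_cases j <;> simp [rotC] <;> fun_prop

theorem phaseMat_mem_unitaryGroup (z : Circle) :
    phaseMat z ∈ Matrix.unitaryGroup (Fin 2) ℂ := by
  have hz : (z : ℂ) * (starRingEnd ℂ) z = 1 := by
    rw [Complex.mul_conj, Circle.normSq_coe]; simp
  rw [Matrix.mem_unitaryGroup_iff]
  ext i j
  fin_cases i <;> fin_cases j <;>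
    simp [phaseMat, Matrix.mul_apply, Matrix.star_apply, Fin.sum_univ_two, hz]

theorem adjRot_apply (u : Matrix (Fin 2) (Fin 2) ℂ) (i j : Fin 3) :
    adjRot u i j =
      (1 / 2 : ℝ) * ((pauliBasis i * u * pauliBasis j * u.conjTranspose).trace).re := rfl

theorem adjRot_phaseMat_mul (z : Circle) (u : Matrix (Fin 2) (Fin 2) ℂ) :
    adjRot (phaseMat z * u) = rotC z * adjRot u := by
  have hz : (z : ℂ).re * (z : ℂ).re + (z : ℂ).im * (z : ℂ).im = 1 := by
    rw [← Complex.normSq_apply, Circle.normSq_coe]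
  ext i j
  rw [Matrix.mul_apply, Fin.sum_univ_three]
  simp only [adjRot_apply]
  fin_cases i <;> fin_cases j <;>
    simp [rotC, phaseMat, pauliBasis, sigmaX, sigmaY, sigmaZ, Matrix.trace, Matrix.mul_apply,
      Fin.sum_univ_two, Matrix.vecMul, Matrix.vecHead, Matrix.vecTail] <;>
    first
      | ring1
      | linear_combination
          (-2 * ((u 1 1).im * (u 1 0).im + (u 1 1).re * (u 1 0).re)) * hz
      | linear_combination
          (-2 * ((u 1 1).re * (u 1 0).im - (u 1 1).im * (u 1 0).re)) * hz
      | linear_combination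
          ((u 1 1).re ^ 2 + (u 1 1).im ^ 2 - (u 1 0).im ^ 2 - (u 1 0).re ^ 2) * hz

theorem adjRot_one : adjRot 1 = 1 := by
  ext i j
  rw [adjRot_apply]
  fin_cases i <;> fin_cases j <;>
    simp [pauliBasis, sigmaX, sigmaY, sigmaZ, Matrix.trace, Fin.sum_univ_two] <;> norm_num

theorem normSq_row_of_mem_unitaryGroup {u : Matrix (Fin 2) (Fin 2) ℂ}
    (hu : u ∈ Matrix.unitaryGroup (Fin 2) ℂ) (i : Fin 2) :
    Complex.normSq (u i 0) + Complex.normSq (u i 1) = 1 := by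
  have h := congrFun (congrFun (Matrix.mem_unitaryGroup_iff.1 hu) i) i
  simp only [Matrix.mul_apply, Fin.sum_univ_two, Matrix.star_apply, Matrix.one_apply_eq] at h
  have h' := congrArg Complex.re h
  simpa [Complex.normSq_apply] using h'

theorem normSq_col_of_mem_unitaryGroup {u : Matrix (Fin 2) (Fin 2) ℂ}
    (hu : u ∈ Matrix.unitaryGroup (Fin 2) ℂ) (j : Fin 2) :
    Complex.normSq (u 0 j) + Complex.normSq (u 1 j) = 1 := by
  have h := congrFun (congrFun (Matrix.mem_unitaryGroup_iff'.1 hu) j) j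
  simp only [Matrix.mul_apply, Fin.sum_univ_two, Matrix.star_apply, Matrix.one_apply_eq] at h
  have h' := congrArg Complex.re h
  simpa [Complex.normSq_apply] using h'

theorem trace_adjRot {u : Matrix (Fin 2) (Fin 2) ℂ} (hu : u ∈ Matrix.unitaryGroup (Fin 2) ℂ) :
    (adjRot u).trace = Complex.normSq u.trace - 1 := by
  have h0 := normSq_row_of_mem_unitaryGroup hu 0
  have h1 := normSq_row_of_mem_unitaryGroup hu 1
  rw [Matrix.trace, Fin.sum_univ_three]
  simp only [Matrix.diag_apply, adjRot_apply]
  simp [pauliBasis, sigmaX, sigmaY, sigmaZ, Matrix.trace, Matrix.mul_apply,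
      Fin.sum_univ_two, Matrix.vecMul, Matrix.vecHead, Matrix.vecTail,
      Complex.normSq_apply] at h0 h1 ⊢
  linear_combination -(1 / 2 : ℝ) * h0 - (1 / 2 : ℝ) * h1

/-- The phase of a rotation close to the `z`-axis circle. -/
def rotPhase (A : Rot) : ℂ := ⟨A 0 0 + A 1 1, A 1 0 - A 0 1⟩

theorem rotPhase_adjRot (u : Matrix (Fin 2) (Fin 2) ℂ) :
    rotPhase (adjRot u) = 2 * (u 1 1 * conj (u 0 0)) := by
  apply Complex.ext
  all_goals
    simp [rotPhase, adjRot_apply, pauliBasis, sigmaX, sigmaY, sigmaZ, Matrix.trace,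
      Matrix.mul_apply, Fin.sum_univ_two, Matrix.vecMul, Matrix.vecHead, Matrix.vecTail]
    ring

theorem rotPhase_one : rotPhase 1 = 2 := by
  apply Complex.ext <;> simp [rotPhase]
  norm_num

theorem continuous_rotPhase : Continuous rotPhase := by
  have h : ∀ i j : Fin 3, Continuous fun A : Rot => A i j := fun i j => by fun_prop
  have : rotPhase = fun A : Rot => ((A 0 0 + A 1 1 : ℝ) : ℂ) +
      ((A 1 0 - A 0 1 : ℝ) : ℂ) * Complex.I := by
    funext A
    apply Complex.ext <;> simp [rotPhase]
  rw [this]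
  fun_prop

theorem sum_normSq_trace {u : Matrix (Fin 2) (Fin 2) ℂ}
    (hu : u ∈ Matrix.unitaryGroup (Fin 2) ℂ) :
    ∑ a : V, Complex.normSq (u * pauliMat a).trace = 4 := by
  have h0 := normSq_row_of_mem_unitaryGroup hu 0
  have h1 := normSq_row_of_mem_unitaryGroup hu 1
  have key : ∀ F : V → ℝ, ∑ a, F a = F (0, 0) + F (0, 1) + (F (1, 0) + F (1, 1)) := by
    intro F
    rw [Fintype.sum_prod_type]
    have hz : ∀ G : ZMod 2 → ℝ, ∑ a, G a = G 0 + G 1 := fun G => Fin.sum_univ_two G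
    simp only [hz]
  rw [key]
  simp [pauliMat, sigmaX, sigmaZ, Matrix.trace, Matrix.mul_apply, ZMod.val_one,
      Fin.sum_univ_two, Complex.normSq_apply] at h0 h1 ⊢
  linear_combination (2 : ℝ) * h0 + (2 : ℝ) * h1

theorem adjRot_eq_one_of_trace_eq_zero {u : Matrix (Fin 2) (Fin 2) ℂ}
    (hu : u ∈ Matrix.unitaryGroup (Fin 2) ℂ)
    (h : ∀ a : V, a ≠ 0 → (u * pauliMat a).trace = 0) : adjRot u = 1 := by
  have hz := h (1, 0) (by decide)
  have hx := h (0, 1) (by decide)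
  have hy := h (1, 1) (by decide)
  simp [pauliMat, sigmaX, sigmaZ, Matrix.trace, Matrix.mul_apply, ZMod.val_one,
      Fin.sum_univ_two] at hz hx hy
  have h01 : u 0 1 = 0 := by linear_combination (1 / 2 : ℂ) * hx - (1 / 2 : ℂ) * hy
  have h10 : u 1 0 = 0 := by linear_combination (1 / 2 : ℂ) * hx + (1 / 2 : ℂ) * hy
  have h11 : u 1 1 = u 0 0 := by linear_combination -hz
  have h0 := normSq_row_of_mem_unitaryGroup hu 0
  rw [h01, Complex.normSq_zero, add_zero, Complex.normSq_apply] at h0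
  ext i j
  rw [adjRot_apply]
  fin_cases i <;> fin_cases j <;>
    simp [pauliBasis, sigmaX, sigmaY, sigmaZ, Matrix.trace, Matrix.mul_apply,
      Fin.sum_univ_two, Matrix.vecMul, Matrix.vecHead, Matrix.vecTail, h01, h10, h11] <;>
    linarith

theorem trace_ne_zero_and_norm_div_le {u : Matrix (Fin 2) (Fin 2) ℂ}
    (hu : u ∈ Matrix.unitaryGroup (Fin 2) ℂ) {ε : ℝ} (hε : 0 < ε)
    (h : 4 / (1 + ε ^ 2) < 1 + (adjRot u).trace) :
    u.trace ≠ 0 ∧ ∀ a : V, a ≠ 0 → ‖(u * pauliMat a).trace / u.trace‖ ≤ ε := by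
  have hpos : 0 < 1 + ε ^ 2 := by positivity
  rw [trace_adjRot hu, div_lt_iff₀ hpos] at h
  have hn : 0 < Complex.normSq u.trace := by
    by_contra hc
    have := Complex.normSq_nonneg u.trace
    nlinarith
  have ht : u.trace ≠ 0 := Complex.normSq_pos.1 hn
  refine ⟨ht, fun a ha => ?_⟩
  rw [norm_div, div_le_iff₀ (norm_pos_iff.2 ht)]
  have hs := sum_normSq_trace hu
  have hle : Complex.normSq (u * pauliMat 0).trace + Complex.normSq (u * pauliMat a).trace ≤ 4 := by
    rw [← hs, ← Finset.sum_pair (f := fun a => Complex.normSq (u * pauliMat a).trace) ha.symm]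
    exact Finset.sum_le_sum_of_subset_of_nonneg (Finset.subset_univ _)
      fun _ _ _ => Complex.normSq_nonneg _
  rw [pauliMat_zero, mul_one, Complex.normSq_eq_norm_sq, Complex.normSq_eq_norm_sq] at hle
  rw [Complex.normSq_eq_norm_sq] at h
  refine abs_le_of_sq_le_sq' ?_ (by positivity) |>.2
  nlinarith

/-- The point of the circle in the direction of `rotPhase A`. -/
def rotAngle (A : Rot) : Circle := Circle.exp (Complex.arg (rotPhase A))

theorem rotAngle_one : rotAngle 1 = 1 := by
  have : Complex.arg 2 = 0 := Complex.ofNat_arg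
  rw [rotAngle, rotPhase_one, this, Circle.exp_zero]

theorem continuousAt_rotAngle : ContinuousAt rotAngle 1 := by
  refine Circle.exp.continuous.continuousAt.comp ?_
  refine ContinuousAt.comp (g := Complex.arg) ?_ continuous_rotPhase.continuousAt
  refine Complex.continuousAt_arg ?_
  rw [rotPhase_one]
  exact Complex.ofNat_mem_slitPlane 2

theorem rotAngle_inv_mul_eq {u : Matrix (Fin 2) (Fin 2) ℂ}
    (hu : u ∈ Matrix.unitaryGroup (Fin 2) ℂ) (h : rotPhase (adjRot u) ≠ 0) :
    (((rotAngle (adjRot u))⁻¹ : Circle) : ℂ) * u 1 1 = u 0 0 := by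
  set w := rotPhase (adjRot u) with hw
  have hw2 : w = 2 * (u 1 1 * conj (u 0 0)) := rotPhase_adjRot u
  have hζ : (‖w‖ : ℂ) * (rotAngle (adjRot u) : ℂ) = w := by
    rw [rotAngle, Circle.coe_exp]
    exact Complex.norm_mul_exp_arg_mul_I w
  have hne : (rotAngle (adjRot u) : ℂ) ≠ 0 := Circle.coe_ne_zero _
  have hn : ‖u 1 1‖ = ‖u 0 0‖ := by
    have h0 := normSq_row_of_mem_unitaryGroup hu 0
    have h1 := normSq_col_of_mem_unitaryGroup hu 1
    rw [Complex.normSq_eq_norm_sq, Complex.normSq_eq_norm_sq] at h0 h1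
    exact (sq_eq_sq₀ (norm_nonneg _) (norm_nonneg _)).1 (by linarith)
  have hwn : ‖w‖ = 2 * (‖u 0 0‖ * ‖u 0 0‖) := by
    rw [hw2, norm_mul, norm_mul, RCLike.norm_conj, hn]; simp
  have h00 : conj (u 0 0) ≠ 0 := by
    intro h0
    rw [hw2, h0] at h
    simp at h
  rw [Circle.coe_inv, inv_mul_eq_iff_eq_mul₀ hne]
  apply mul_right_cancel₀ h00
  have hc : u 0 0 * conj (u 0 0) = (‖u 0 0‖ : ℂ) * ‖u 0 0‖ := by
    rw [Complex.mul_conj, Complex.normSq_eq_norm_sq]; push_cast; ring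
  rw [hwn, hw2] at hζ
  push_cast at hζ
  rw [mul_assoc, hc]
  linear_combination -(1 / 2 : ℂ) * hζ

theorem trace_mul_pauliMat_z (u : Matrix (Fin 2) (Fin 2) ℂ) :
    (u * pauliMat (1, 0)).trace = u 0 0 - u 1 1 := by
  simp [pauliMat, sigmaZ, Matrix.trace, Matrix.mul_apply, ZMod.val_one, Fin.sum_univ_two]
  ring

section Torus

variable {L : Submodule (ZMod 2) (QV P)}

/-- Tuples of rotations about the `z`-axis whose product over each protected contiguity
class is trivial. -/
def torus (L : Submodule (ZMod 2) (QV P)) : Set (P → Rot) :=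
  {g | ∃ z : P → Circle, (∀ p, g p = rotC (z p)) ∧
    ∀ p, IsProtected L p → ∏ q with Contig L p q, z q = 1}

theorem one_mem_torus : (1 : P → Rot) ∈ torus L :=
  ⟨1, fun _ => rotC_one.symm, fun _ _ => Finset.prod_eq_one fun _ _ => rfl⟩

theorem mul_mem_torus {g g' : P → Rot} (hg : g ∈ torus L) (hg' : g' ∈ torus L) :
    g * g' ∈ torus L := by
  obtain ⟨z, hz, hz1⟩ := hg
  obtain ⟨w, hw, hw1⟩ := hg'
  refine ⟨z * w, fun p => by rw [Pi.mul_apply, hz, hw, Pi.mul_apply, rotC_mul], fun p hp => ?_⟩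
  simp only [Pi.mul_apply, Finset.prod_mul_distrib, hz1 p hp, hw1 p hp, one_mul]

theorem exists_inv_mem_torus {g : P → Rot} (hg : g ∈ torus L) :
    ∃ g' ∈ torus L, g' * g = 1 ∧ g * g' = 1 := by
  obtain ⟨z, hz, hz1⟩ := hg
  refine ⟨fun p => rotC (z p)⁻¹, ⟨fun p => (z p)⁻¹, fun _ => rfl, fun p hp => ?_⟩, ?_, ?_⟩
  · rw [Finset.prod_inv_distrib, hz1 p hp, inv_one]
  · funext p
    rw [Pi.mul_apply, hz, ← rotC_mul, inv_mul_cancel, rotC_one, Pi.one_apply]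
  · funext p
    rw [Pi.mul_apply, hz, ← rotC_mul, mul_inv_cancel, rotC_one, Pi.one_apply]

namespace ZAligned

theorem mul_mem_autSet (h : ZAligned L) {σ : PauliSection L}
    (hσ : ∀ v ∈ L, (∀ p, (v p).2 = 0) → σ.toFun v = Wop v)
    {g g' : P → Rot} (hg : g ∈ torus L) (hg' : g' ∈ autSet L σ) : g * g' ∈ autSet L σ := by
  obtain ⟨z, hz, hz1⟩ := hg
  obtain ⟨u, hu, hug, huc⟩ := hg'
  refine ⟨fun p => phaseMat (z p) * u p, fun p => mul_mem (phaseMat_mem_unitaryGroup _) (hu p),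
    fun p => ?_, fun ψ hψ => ?_⟩
  · rw [adjRot_phaseMat_mul, hug, Pi.mul_apply, hz]
  · rw [← locOp_mul, ← Matrix.mulVec_mulVec]
    exact h.locOp_phaseMat_mem_code hσ hz1 (huc ψ hψ)

theorem torus_subset_autSet (h : ZAligned L) {σ : PauliSection L}
    (hσ : ∀ v ∈ L, (∀ p, (v p).2 = 0) → σ.toFun v = Wop v) : torus L ⊆ autSet L σ := by
  intro g hg
  have h1 : (1 : P → Rot) ∈ autSet L σ :=
    ⟨fun _ => 1, fun _ => one_mem _, fun _ => adjRot_one, fun ψ hψ => by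
      rwa [locOp_one, Matrix.one_mulVec]⟩
  simpa using h.mul_mem_autSet hσ hg h1

/-- Qubits which are the chosen representative of a protected contiguity class. -/
def IsPivot (h : ZAligned L) (p : P) : Prop := IsProtected L p ∧ h.rep p = p

/-- Adjust a tuple at the representatives of the protected contiguity classes so that its
product over every such class becomes trivial. -/
def complete (h : ZAligned L) (w : P → Circle) (p : P) : Circle :=
  if h.IsPivot p then (∏ q with Contig L p q ∧ q ≠ p, w q)⁻¹ else w p

theorem complete_of_not_isPivot (h : ZAligned L) (w : P → Circle) {p : P}
    (hp : ¬ h.IsPivot p) : h.complete w p = w p := if_neg hp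

theorem filter_contig_ne (p : P) :
    (Finset.univ.filter fun q => Contig L p q ∧ q ≠ p) =
      (Finset.univ.filter fun q => Contig L p q).erase p := by
  ext q
  simp [and_comm]

theorem isPivot_rep (h : ZAligned L) {p : P} (hp : IsProtected L p) : h.IsPivot (h.rep p) :=
  ⟨(h.isProtected_congr (h.contig_rep p)).2 hp, h.rep_rep p⟩

theorem prod_complete (h : ZAligned L) (w : P → Circle) {p : P} (hp : IsProtected L p) :
    ∏ q with Contig L p q, h.complete w q = 1 := by
  have hf : (Finset.univ.filter fun q => Contig L p q) =
      Finset.univ.filter fun q => Contig L (h.rep p) q := by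
    ext q
    simp only [Finset.mem_filter, Finset.mem_univ, true_and, ← h.rep_eq_iff, h.rep_rep]
  have hr := h.isPivot_rep hp
  rw [hf, ← Finset.mul_prod_erase _ _ (by simpa using contig_refl (h.rep p)),
    complete, if_pos hr, filter_contig_ne, inv_mul_eq_one]
  refine Finset.prod_congr rfl fun q hq => ?_
  simp only [Finset.mem_erase, Finset.mem_filter, Finset.mem_univ, true_and] at hq
  refine (h.complete_of_not_isPivot w fun hq' => hq.1 ?_).symm
  rw [← hq'.2, ← h.rep_eq_iff.2 hq.2, h.rep_rep]

theorem complete_eq_self (h : ZAligned L) {z : P → Circle}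
    (hz : ∀ p, IsProtected L p → ∏ q with Contig L p q, z q = 1) : h.complete z = z := by
  funext p
  by_cases hp : h.IsPivot p
  · have := hz p hp.1
    rw [← Finset.mul_prod_erase _ _ (show p ∈ _ by simpa using contig_refl p)] at this
    rw [complete, if_pos hp, filter_contig_ne, ← mul_eq_one_iff_inv_eq', mul_comm]
    rw [mul_comm, this]
  · exact h.complete_of_not_isPivot z hp

theorem complete_congr (h : ZAligned L) {w w' : P → Circle}
    (hw : ∀ p, ¬ h.IsPivot p → w p = w' p) : h.complete w = h.complete w' := by
  funext p
  by_cases hp : h.IsPivot p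
  · rw [complete, complete, if_pos hp, if_pos hp]
    congr 1
    refine Finset.prod_congr rfl fun q hq => hw q fun hq' => ?_
    simp only [Finset.mem_filter, Finset.mem_univ, true_and] at hq
    exact hq.2 (by rw [← hq'.2, ← h.rep_eq_iff.2 hq.1, hp.2])
  · rw [h.complete_of_not_isPivot _ hp, h.complete_of_not_isPivot _ hp, hw p hp]

theorem complete_one (h : ZAligned L) : h.complete 1 = 1 :=
  h.complete_eq_self fun _ _ => Finset.prod_eq_one fun _ _ => rfl

theorem continuous_complete (h : ZAligned L) : Continuous h.complete := by
  refine continuous_pi fun p => ?_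
  unfold complete
  split_ifs
  · exact (continuous_finsetProd _ fun q _ => continuous_apply q).inv
  · exact continuous_apply p

theorem rotC_complete_mem_torus (h : ZAligned L) (w : P → Circle) :
    (fun p => rotC (h.complete w p)) ∈ torus L :=
  ⟨h.complete w, fun _ => rfl, fun _ hp => h.prod_complete w hp⟩

/-- An automorphism all of whose lifts are close to scalars and whose phases vanish away
from the pivots is trivial. -/
theorem eq_one_of_mem_autSet (h : ZAligned L) {σ : PauliSection L} {ε : ℝ} (hε0 : 0 < ε)
    (hε1 : ε < 1) (hε : Fintype.card (QV P) * ε < 1) {u : P → Matrix (Fin 2) (Fin 2) ℂ}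
    (hu : ∀ p, u p ∈ Matrix.unitaryGroup (Fin 2) ℂ)
    (hU : ∀ ψ ∈ code L σ, locOp u *ᵥ ψ ∈ code L σ)
    (htr : ∀ p, 4 / (1 + ε ^ 2) < 1 + (adjRot (u p)).trace)
    (hdiag : ∀ p, ¬ h.IsPivot p → u p 0 0 = u p 1 1) (p : P) : adjRot (u p) = 1 := by
  have ht0 : ∀ p, (u p).trace ≠ 0 := fun p =>
    (trace_ne_zero_and_norm_div_le (hu p) hε0 (htr p)).1
  choose s hs hsum using coset_equation σ hU
  have key := h.eq_zero_of_coset_equations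
    (fun p a => (u p * pauliMat a).trace / (u p).trace)
    (fun p => by rw [pauliMat_zero, mul_one, div_self (ht0 p)])
    (fun p a => s (Pi.single p a)) (fun p a v _ => hs _ v)
    (fun p a ⟨v, hv, hva⟩ => by
      have := hsum (Pi.single p a) ⟨v, hv, by rwa [omega_single]⟩
      simp only [Finset.prod_div_distrib, ← mul_div_assoc, ← Finset.sum_div, this, zero_div])
    (fun p hp => by rw [trace_mul_pauliMat_z, hdiag p hp, sub_self, zero_div])
    hε1 hε (fun p a ha => (trace_ne_zero_and_norm_div_le (hu p) hε0 (htr p)).2 a ha)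
  exact adjRot_eq_one_of_trace_eq_zero (hu p) fun a ha =>
    (div_eq_zero_iff.1 (key p a ha)).resolve_right (ht0 p)

theorem eventually_mem_torus (h : ZAligned L) {σ : PauliSection L}
    (hσ : ∀ v ∈ L, (∀ p, (v p).2 = 0) → σ.toFun v = Wop v) :
    ∀ᶠ g in nhds (1 : P → Rot), g ∈ autSet L σ → g ∈ torus L := by
  obtain ⟨ε, hε0, hε1, hε⟩ : ∃ ε : ℝ, 0 < ε ∧ ε < 1 ∧ Fintype.card (QV P) * ε < 1 := by
    have hc : (0 : ℝ) < Fintype.card (QV P) := by exact_mod_cast Fintype.card_pos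
    refine ⟨1 / (Fintype.card (QV P) + 1), by positivity, ?_, ?_⟩
    · rw [div_lt_one (by positivity)]; linarith
    · rw [mul_one_div, div_lt_one (by positivity)]; linarith
  let t : (P → Rot) → P → Circle := fun g => h.complete fun q => (rotAngle (g q))⁻¹
  have ht1 : t 1 = 1 := by
    have : (fun q => (rotAngle ((1 : P → Rot) q))⁻¹) = (1 : P → Circle) := by
      funext q
      rw [Pi.one_apply, rotAngle_one, inv_one, Pi.one_apply]
    simp only [t, this, h.complete_one]
  have ht : ContinuousAt t 1 := by
    refine h.continuous_complete.continuousAt.comp (continuousAt_pi.2 fun q => ?_)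
    have : ContinuousAt (fun g : P → Rot => rotAngle (g q)) 1 :=
      ContinuousAt.comp (f := fun g : P → Rot => g q) (x := 1) continuousAt_rotAngle
        (continuous_apply q).continuousAt
    exact this.inv
  have htrace : ∀ p, ∀ᶠ g in nhds (1 : P → Rot),
      4 / (1 + ε ^ 2) < 1 + (rotC (t g p) * g p).trace := fun p => by
    have hc : ContinuousAt (fun g : P → Rot => 1 + (rotC (t g p) * g p).trace) 1 := by
      have h1 : ContinuousAt (fun g : P → Rot => rotC (t g p)) 1 :=
        continuous_rotC.continuousAt.comp (continuousAt_pi.1 ht p)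
      have h2 : ContinuousAt (fun g : P → Rot => rotC (t g p) * g p) 1 :=
        h1.mul (continuous_apply p).continuousAt
      exact continuousAt_const.add
        (ContinuousAt.comp (g := Matrix.trace) continuous_id.matrix_trace.continuousAt h2)
    refine hc.eventually (lt_mem_nhds ?_)
    beta_reduce
    rw [ht1, Pi.one_apply, Pi.one_apply, rotC_one, mul_one, Matrix.trace_one, Fintype.card_fin,
      div_lt_iff₀ (by positivity)]
    push_cast
    nlinarith
  have hphase : ∀ p, ∀ᶠ g in nhds (1 : P → Rot), rotPhase (g p) ≠ 0 := fun p => by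
    refine (continuous_rotPhase.comp (continuous_apply p)).continuousAt.eventually_ne ?_
    simp [rotPhase_one]
  filter_upwards [Filter.eventually_all.2 htrace, Filter.eventually_all.2 hphase]
    with g hg1 hg2 ⟨u, hu, hug, huc⟩
  have hone := h.eq_one_of_mem_autSet (σ := σ) hε0 hε1 hε
    (u := fun p => phaseMat (t g p) * u p)
    (fun p => mul_mem (phaseMat_mem_unitaryGroup _) (hu p))
    (fun ψ hψ => by
      rw [← locOp_mul, ← Matrix.mulVec_mulVec]
      exact h.locOp_phaseMat_mem_code hσ (fun p hp => h.prod_complete _ hp) (huc ψ hψ))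
    (fun p => by rw [adjRot_phaseMat_mul, hug]; exact hg1 p)
    (fun p hp => by
      have := rotAngle_inv_mul_eq (hu p) (by rw [hug]; exact hg2 p)
      simp only [t, h.complete_of_not_isPivot _ hp, ← hug]
      simp [phaseMat, Matrix.mul_apply, Fin.sum_univ_two]
      simpa using this.symm)
  refine ⟨fun p => (t g p)⁻¹, fun p => ?_, fun p hp => ?_⟩
  · have := hone p
    rw [adjRot_phaseMat_mul, hug] at this
    rw [← one_mul (g p), ← rotC_one, ← inv_mul_cancel (t g p), rotC_mul, mul_assoc, this, mul_one]
  · rw [Finset.prod_inv_distrib, h.prod_complete _ hp, inv_one]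

end ZAligned

end Torus

section Component

variable {L : Submodule (ZMod 2) (QV P)}

namespace ZAligned

/-- The parametrisation of the torus by the coordinates away from the pivots. -/
def torusParam (h : ZAligned L) (w : {p // ¬ h.IsPivot p} → Circle) : torus L :=
  ⟨_, h.rotC_complete_mem_torus fun p => if hp : h.IsPivot p then 1 else w ⟨p, hp⟩⟩

theorem continuous_torusParam (h : ZAligned L) : Continuous h.torusParam := by
  have hc : Continuous fun (w : {p // ¬ h.IsPivot p} → Circle) (p : P) =>
      if hp : h.IsPivot p then 1 else w ⟨p, hp⟩ := by
    refine continuous_pi fun q => ?_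
    split_ifs with hq
    · exact continuous_const
    · exact continuous_apply _
  exact Continuous.subtype_mk (continuous_pi fun p => continuous_rotC.comp
    ((continuous_apply p).comp (h.continuous_complete.comp hc))) _

theorem bijective_torusParam (h : ZAligned L) : Function.Bijective h.torusParam := by
  constructor
  · intro w w' hww
    funext ⟨p, hp⟩
    have := rotC_injective (congrFun (congrArg Subtype.val hww) p)
    simpa only [h.complete_of_not_isPivot _ hp, dif_neg hp] using this
  · rintro ⟨g, z, hz, hz1⟩
    refine ⟨fun p => z p, Subtype.ext (funext fun p => ?_)⟩
    refine Eq.trans ?_ (hz p).symm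
    rw [← h.complete_eq_self hz1]
    refine congrArg rotC (congrFun (h.complete_congr fun q hq => ?_) p)
    rw [dif_neg hq, h.complete_eq_self hz1]

/-- The torus is homeomorphic to a power of the circle. -/
def torusHomeo (h : ZAligned L) : ({p // ¬ h.IsPivot p} → Circle) ≃ₜ torus L :=
  Continuous.homeoOfEquivCompactToT2 (f := Equiv.ofBijective _ h.bijective_torusParam)
    h.continuous_torusParam

theorem isCompact_torus (h : ZAligned L) : IsCompact (torus L) :=
  isCompact_iff_compactSpace.2 h.torusHomeo.compactSpace

theorem isPreconnected_torus (h : ZAligned L) : IsPreconnected (torus L) := by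
  rw [isPreconnected_iff_preconnectedSpace]
  exact h.torusHomeo.surjective.denseRange.preconnectedSpace h.torusHomeo.continuous

theorem card_not_isPivot (h : ZAligned L) :
    Fintype.card {p // ¬ h.IsPivot p} = Fintype.card P -
      Set.ncard {S : Set P | ∃ p : P, IsProtected L p ∧ S = contigClass L p} := by
  have himg : {S : Set P | ∃ p : P, IsProtected L p ∧ S = contigClass L p} =
      contigClass L '' {p | h.IsPivot p} := by
    ext S
    constructor
    · rintro ⟨p, hp, rfl⟩
      refine ⟨h.rep p, h.isPivot_rep hp, Set.ext fun q => ?_⟩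
      simp only [contigClass, Set.mem_ofPred_eq, ← h.rep_eq_iff, h.rep_rep]
    · rintro ⟨p, hp, rfl⟩
      exact ⟨p, hp.1, rfl⟩
  have hinj : Set.InjOn (contigClass L) {p | h.IsPivot p} := by
    intro p hp q hq hpq
    have : q ∈ contigClass L p := hpq ▸ contig_refl q
    rw [← hp.2, ← hq.2]
    exact h.rep_eq_iff.2 this
  rw [himg, hinj.ncard_image, Fintype.card_subtype_compl, ← Nat.card_coe_set_eq,
    Nat.card_eq_fintype_card]
  rfl

theorem connectedComponentIn_autSet (h : ZAligned L) {σ : PauliSection L}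
    (hσ : ∀ v ∈ L, (∀ p, (v p).2 = 0) → σ.toFun v = Wop v) :
    connectedComponentIn (autSet L σ) 1 = torus L := by
  have hsub := h.torus_subset_autSet hσ
  refine Set.Subset.antisymm ?_
    (h.isPreconnected_torus.subset_connectedComponentIn one_mem_torus hsub)
  obtain ⟨U, hU, hUo, h1U⟩ := eventually_nhds_iff.1 (h.eventually_mem_torus hσ)
  set O : Set (P → Rot) := ⋃ t ∈ torus L, (fun g => t * g) ⁻¹' U with hO
  have hOo : IsOpen O := isOpen_biUnion fun t _ => hUo.preimage (continuous_const_mul t)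
  have hTO : torus L ⊆ O := fun g hg => by
    obtain ⟨t, ht, htg, -⟩ := exists_inv_mem_torus hg
    exact Set.mem_biUnion ht (by rwa [Set.mem_preimage, htg])
  have hAO : autSet L σ ∩ O ⊆ torus L := by
    rintro g ⟨hgA, hgO⟩
    obtain ⟨t, ht, htg⟩ := Set.mem_iUnion₂.1 hgO
    obtain ⟨t', ht', htt, -⟩ := exists_inv_mem_torus ht
    rw [← one_mul g, ← htt, mul_assoc]
    exact mul_mem_torus ht' (hU _ htg (h.mul_mem_autSet hσ ht hgA))
  have hCA : connectedComponentIn (autSet L σ) 1 ⊆ autSet L σ := connectedComponentIn_subset _ _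
  have h1C : (1 : P → Rot) ∈ connectedComponentIn (autSet L σ) 1 :=
    mem_connectedComponentIn (hsub one_mem_torus)
  intro g hg
  by_contra hgT
  obtain ⟨x, hxC, hxO, hxT⟩ := isPreconnected_connectedComponentIn (F := autSet L σ) (x := 1)
    O (torus L)ᶜ hOo h.isCompact_torus.isClosed.isOpen_compl
    (fun x _ => (em (x ∈ torus L)).imp (fun hx => hTO hx) id)
    ⟨1, h1C, hTO one_mem_torus⟩ ⟨g, hg, hgT⟩
  exact hxT (hAO ⟨hCA hxC, hxO⟩)

end ZAligned

theorem exp_finsum_contigClass (p : P) (θ : P → ℝ) :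
    Circle.exp (∑ᶠ q ∈ contigClass L p, θ q) = ∏ q with Contig L p q, Circle.exp (θ q) := by
  have hs : contigClass L p = ↑(Finset.univ.filter fun q => Contig L p q) := by
    ext q
    simp [contigClass]
  rw [hs, finsum_mem_coe_finset]
  induction Finset.univ.filter fun q => Contig L p q using Finset.induction_on with
  | empty => simp
  | insert a s ha ih => rw [Finset.sum_insert ha, Finset.prod_insert ha, Circle.exp_add, ih]

theorem torus_eq_setOf_rotZ :
    torus L = {g | ∃ θ : P → ℝ, (∀ p, g p = rotZ (θ p)) ∧
      ∀ p : P, IsProtected L p → rotZ (∑ᶠ q ∈ contigClass L p, θ q) = 1} := by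
  ext g
  simp only [Set.mem_ofPred_eq, torus, rotZ_eq_rotC, exp_finsum_contigClass, ← rotC_one,
    rotC_injective.eq_iff]
  constructor
  · rintro ⟨z, hz, hz1⟩
    choose θ hθ using fun p => Circle.exp_surjective (z p)
    exact ⟨θ, fun p => by rw [hθ, hz], fun p hp => by simpa only [hθ] using hz1 p hp⟩
  · rintro ⟨θ, hθ, hθ1⟩
    exact ⟨fun p => Circle.exp (θ p), hθ, hθ1⟩

end Component

/-- **Theorem (the connected automorphism group).** Let `L ⊆ V^P` be an isotropic
subspace free of zero, trivial, and Bell factors. After a suitable local symplectic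
transformation and for a suitable section `σ`, the connected component of the identity
of the automorphism group is the torus
`A_c(L, σ) = {(g_p) ∈ (C_z)^P | Π_{s ∈ S} g_s = 1 for every protected class S}`,
of dimension `|P|` minus the number of protected contiguity classes. -/
theorem connected_automorphism_group {P : Type} [Fintype P] [DecidableEq P]
    (L : Submodule (ZMod 2) (QV P)) (hL : Isotropic L)
    (hzero : ¬ HasZeroFactor L) (htriv : ¬ HasTrivialFactor L)
    (hbell : ¬ HasBellFactor L) :
    ∃ f : P → (V ≃ₗ[ZMod 2] V), IsLocalSymp f ∧
      ∃ σ' : PauliSection (mapL L f),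
        connectedComponentIn (autSet (mapL L f) σ') 1 =
          {g | ∃ θ : P → ℝ, (∀ p, g p = rotZ (θ p)) ∧
            ∀ p : P, IsProtected (mapL L f) p →
              rotZ (∑ᶠ q ∈ contigClass (mapL L f) p, θ q) = 1} ∧
        Nonempty (↥(connectedComponentIn (autSet (mapL L f) σ') 1) ≃ₜ
          (Fin (Fintype.card P -
            Set.ncard {S : Set P | ∃ p : P, IsProtected (mapL L f) p ∧
              S = contigClass (mapL L f) p}) → Circle)) := by
  obtain ⟨f, hf, h⟩ := exists_zAligned hL hzero htriv hbell
  obtain ⟨σ, hσ⟩ := exists_section h.isotropic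
  have hT := h.connectedComponentIn_autSet hσ
  refine ⟨f, hf, σ, hT.trans torus_eq_setOf_rotZ, ⟨?_⟩⟩
  refine (Homeomorph.setCongr hT).trans (h.torusHomeo.symm.trans ?_)
  exact Homeomorph.piCongrLeft (Y := fun _ => Circle)
    (Fintype.equivFinOfCardEq h.card_not_isPivot)

end Stab
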